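/- arXiv:1507.03064 — 2 statements merged into one kernel-verified Lean document; each statement's English description precedes it below -/
import Mathlib

section
/- For nilpotent representations of a cyclic quiver (or of the quiver A_∞^∞), degeneration is compatible with generic extension: if M' ≤_deg M and N' ≤_deg N then M' * N' ≤_deg M * N, where * denotes the generic extension. -/
/-- A finite-dimensional nilpotent representation of the cyclic quiver `Δ_n`
(vertices `ℤ/nℤ`, arrows `i → i+1`), encoded as a finite-dimensional `k`-vector space `M`
together with a complete family of orthogonal projections `pr i` (the graded pieces, one for
each vertex `i ∈ ℤ/nℤ`) and a nilpotent linear map `t` (the sum of the arrow maps) moving the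
degree-`i` piece into the degree-`(i+1)` piece. -/
structure NilRep (n : ℕ) [NeZero n] (k : Type) [Field k] where
  M : Type
  [grp : AddCommGroup M]
  [mod : Module k M]
  [fin : FiniteDimensional k M]
  pr : ZMod n → (M →ₗ[k] M)
  t : M →ₗ[k] M
  idem : ∀ i j, (pr i) ∘ₗ (pr j) = if i = j then pr i else 0
  sum : ∑ i, pr i = LinearMap.id
  comm : ∀ i, t ∘ₗ pr i = pr (i + 1) ∘ₗ t
  nil : IsNilpotent t

attribute [instance] NilRep.grp NilRep.mod NilRep.fin

variable {n : ℕ} [NeZero n] {k : Type} [Field k]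

/-- A morphism of representations: a linear map commuting with the gradings and with the
arrow maps. -/
def IsRepHom (A B : NilRep n k) (f : A.M →ₗ[k] B.M) : Prop :=
  (∀ i, f ∘ₗ A.pr i = B.pr i ∘ₗ f) ∧ f ∘ₗ A.t = B.t ∘ₗ f

/-- The space `Hom(A, B)` of morphisms of representations, as a submodule of the linear maps. -/
def HomSub (A B : NilRep n k) : Submodule k (A.M →ₗ[k] B.M) where
  carrier := {f | IsRepHom A B f}
  add_mem' := by
    rintro f g ⟨hf1, hf2⟩ ⟨hg1, hg2⟩
    exact ⟨fun i => by simp [LinearMap.add_comp, LinearMap.comp_add, hf1 i, hg1 i],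
      by simp [LinearMap.add_comp, LinearMap.comp_add, hf2, hg2]⟩
  zero_mem' := ⟨fun i => by simp, by simp⟩
  smul_mem' := by
    rintro c f ⟨hf1, hf2⟩
    exact ⟨fun i => by simp [LinearMap.smul_comp, LinearMap.comp_smul, hf1 i],
      by simp [LinearMap.smul_comp, LinearMap.comp_smul, hf2]⟩

/-- `dim Hom(A, B)`. -/
noncomputable def homDim (A B : NilRep n k) : ℕ := Module.finrank k (HomSub A B)

/-- The dimension vector of a representation: the dimension of the degree-`i` piece. -/
noncomputable def dimAt (A : NilRep n k) (i : ZMod n) : ℕ :=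
  Module.finrank k (LinearMap.range (A.pr i))

/-- The degeneration order: `DegLe A B` means `A ≤_deg B`, i.e. `A` and `B` have the same
dimension vector and `dim Hom(A, X) ≥ dim Hom(B, X)` for every test representation `X`. -/
def DegLe (A B : NilRep n k) : Prop :=
  (∀ i, dimAt A i = dimAt B i) ∧ ∀ X : NilRep n k, homDim B X ≤ homDim A X

/-- Isomorphism of representations. -/
def IsoRep (A B : NilRep n k) : Prop :=
  ∃ f : A.M ≃ₗ[k] B.M, IsRepHom A B (f : A.M →ₗ[k] B.M)

/-- `C` is an extension of `A` by `B`: there is a short exact sequence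
`0 → B → C → A → 0` of representations. -/
def IsExtensionOf (C A B : NilRep n k) : Prop :=
  ∃ (f : B.M →ₗ[k] C.M) (g : C.M →ₗ[k] A.M),
    IsRepHom B C f ∧ IsRepHom C A g ∧ Function.Injective f ∧ Function.Surjective g ∧
      LinearMap.range f = LinearMap.ker g

/-- `G` is the generic extension `A * B`: it is an extension of `A` by `B` which is maximal
among all such extensions with respect to the degeneration order. -/
def IsGenericExt (A B G : NilRep n k) : Prop :=
  IsExtensionOf G A B ∧ ∀ C : NilRep n k, IsExtensionOf C A B → DegLe C G

open Module LinearMap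

theorem linearIndependent_pow_apply {V : Type*} [AddCommGroup V] [Module k V]
    {S : V →ₗ[k] V} (hS : IsNilpotent S) {x : V} {w : ℕ} (hx : (S ^ w) x ≠ 0) :
    LinearIndependent k (fun c : Fin (w + 1) => (S ^ (c : ℕ)) x) := by
  classical
  obtain ⟨r, hr⟩ := hS
  have hex : ∃ d, (S ^ d) x = 0 := ⟨r, by simp [hr]⟩
  obtain ⟨D, hD0, hD1⟩ : ∃ D, (S ^ D) x ≠ 0 ∧ (S ^ (D + 1)) x = 0 := by
    have hpos : Nat.find hex ≠ 0 := by
      intro h0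
      have := Nat.find_spec hex
      rw [h0] at this
      exact hx (by rw [pow_zero, End.one_apply] at this; simp [this])
    refine ⟨Nat.find hex - 1, Nat.find_min hex (by omega), ?_⟩
    rw [Nat.sub_add_cancel (by omega)]
    exact Nat.find_spec hex
  have hzero : ∀ d, D < d → (S ^ d) x = 0 := by
    intro d hd
    obtain ⟨e, rfl⟩ := Nat.exists_eq_add_of_le' hd
    rw [pow_add, End.mul_apply, hD1, map_zero]
  have hwD : w ≤ D := by
    by_contra h
    exact hx (hzero w (by omega))
  rw [Fintype.linearIndependent_iff]
  intro g hg
  have key : ∀ c : ℕ, ∀ hc : c < w + 1, g ⟨c, hc⟩ = 0 := by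
    intro c
    induction c using Nat.strong_induction_on with
    | _ c ih =>
      intro hc
      have h1 := congrArg (S ^ (D - c)) hg
      rw [map_zero, map_sum, Finset.sum_eq_single ⟨c, hc⟩] at h1
      · rw [map_smul, ← End.mul_apply, ← pow_add, Nat.sub_add_cancel (by omega)] at h1
        exact (smul_eq_zero.mp h1).resolve_right hD0
      · intro b _ hb
        rw [map_smul, ← End.mul_apply, ← pow_add]
        rcases lt_or_ge (b : ℕ) c with h | h
        · rw [ih b h b.2, zero_smul]
        · have : (b : ℕ) ≠ c := fun h' => hb (Fin.ext h')
          rw [hzero _ (by omega), smul_zero]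
      · simp
  exact fun i => key i i.2

namespace NilRep

theorem pr_pr (A : NilRep n k) (i j : ZMod n) (a : A.M) :
    A.pr i (A.pr j a) = if i = j then A.pr i a else 0 := by
  have := LinearMap.congr_fun (A.idem i j) a
  rw [LinearMap.comp_apply] at this
  rw [this]
  split_ifs <;> rfl

theorem pr_pr_self (A : NilRep n k) (i : ZMod n) (a : A.M) :
    A.pr i (A.pr i a) = A.pr i a := by rw [pr_pr, if_pos rfl]

theorem sum_pr (A : NilRep n k) (a : A.M) : ∑ i, A.pr i a = a := by
  have := LinearMap.congr_fun A.sum a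
  simpa using this

theorem t_pr (A : NilRep n k) (i : ZMod n) (a : A.M) :
    A.t (A.pr i a) = A.pr (i + 1) (A.t a) := LinearMap.congr_fun (A.comm i) a

theorem pow_t_pr (A : NilRep n k) (m : ℕ) (i : ZMod n) (a : A.M) :
    (A.t ^ m) (A.pr i a) = A.pr (i + m) ((A.t ^ m) a) := by
  induction m generalizing i a with
  | zero => simp
  | succ m ih =>
    rw [pow_succ, End.mul_apply, t_pr, ih, End.mul_apply]
    congr 2
    push_cast
    ring

/-- The rank of the composite of `m` arrow maps starting at the vertex `i`. -/
noncomputable def rk (A : NilRep n k) (m : ℕ) (i : ZMod n) : ℕ :=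
  finrank k (range ((A.t ^ m) ∘ₗ A.pr i))

theorem rk_zero (A : NilRep n k) (i : ZMod n) : A.rk 0 i = dimAt A i := by
  rw [rk, dimAt, pow_zero, End.one_eq_id, LinearMap.id_comp]

theorem le_rk (A : NilRep n k) {m w : ℕ} {i : ZMod n} {x : A.M} (hx : A.pr i x = x)
    (h : (A.t ^ (m + n * w)) x ≠ 0) : w + 1 ≤ A.rk m i := by
  have hS : IsNilpotent (A.t ^ n) := A.nil.pow_of_pos (NeZero.ne n)
  have hx' : ((A.t ^ n) ^ w) ((A.t ^ m) x) ≠ 0 := by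
    rwa [← pow_mul, ← End.mul_apply, ← pow_add, add_comm]
  have hli := linearIndependent_pow_apply hS hx'
  have h1 := finrank_span_eq_card hli
  rw [Fintype.card_fin] at h1
  rw [← h1, rk]
  apply Submodule.finrank_mono
  rw [Submodule.span_le]
  rintro _ ⟨c, rfl⟩
  refine ⟨(A.t ^ (n * (c : ℕ))) x, ?_⟩
  have h2 : A.pr i ((A.t ^ (n * (c : ℕ))) x) = (A.t ^ (n * (c : ℕ))) x := by
    have := A.pow_t_pr (n * c) i x
    rw [hx] at this
    simpa using this.symm
  rw [LinearMap.comp_apply, h2]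
  simp only
  rw [← pow_mul, ← End.mul_apply, ← End.mul_apply, ← pow_add, ← pow_add, add_comm]

end NilRep

theorem IsRepHom.pr_apply {A B : NilRep n k} {f : A.M →ₗ[k] B.M} (h : IsRepHom A B f)
    (i : ZMod n) (a : A.M) : f (A.pr i a) = B.pr i (f a) := LinearMap.congr_fun (h.1 i) a

theorem IsRepHom.t_apply {A B : NilRep n k} {f : A.M →ₗ[k] B.M} (h : IsRepHom A B f)
    (a : A.M) : f (A.t a) = B.t (f a) := LinearMap.congr_fun h.2 a

theorem IsRepHom.pow_t_apply {A B : NilRep n k} {f : A.M →ₗ[k] B.M} (h : IsRepHom A B f)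
    (m : ℕ) (a : A.M) : f ((A.t ^ m) a) = (B.t ^ m) (f a) := by
  induction m generalizing a with
  | zero => simp
  | succ m ih => rw [pow_succ, End.mul_apply, ih, h.t_apply, pow_succ, End.mul_apply]

theorem IsRepHom.comp {A B C : NilRep n k} {g : B.M →ₗ[k] C.M} {f : A.M →ₗ[k] B.M}
    (hg : IsRepHom B C g) (hf : IsRepHom A B f) : IsRepHom A C (g ∘ₗ f) :=
  ⟨fun i => LinearMap.ext fun a => by simp [hf.pr_apply, hg.pr_apply],
    LinearMap.ext fun a => by simp [hf.t_apply, hg.t_apply]⟩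

theorem IsRepHom.symm {A B : NilRep n k} {e : A.M ≃ₗ[k] B.M}
    (h : IsRepHom A B (e : A.M →ₗ[k] B.M)) : IsRepHom B A (e.symm : B.M →ₗ[k] A.M) := by
  constructor
  · intro i
    ext b
    apply e.injective
    have := h.pr_apply i (e.symm b)
    simp only [LinearEquiv.coe_coe] at this
    simp [this]
  · ext b
    apply e.injective
    have := h.t_apply (e.symm b)
    simp only [LinearEquiv.coe_coe] at this
    simp [this]

theorem IsoRep.symm {A B : NilRep n k} : IsoRep A B → IsoRep B A := by
  rintro ⟨e, he⟩
  exact ⟨e.symm, he.symm⟩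

theorem IsoRep.trans {A B C : NilRep n k} : IsoRep A B → IsoRep B C → IsoRep A C := by
  rintro ⟨e, he⟩ ⟨e', he'⟩
  exact ⟨e.trans e', he'.comp he⟩

theorem IsoRep.of_bijective {A B : NilRep n k} {f : A.M →ₗ[k] B.M} (hf : IsRepHom A B f)
    (hb : Function.Bijective f) : IsoRep A B :=
  ⟨LinearEquiv.ofBijective f hb, hf⟩

theorem IsoRep.rk_eq {A B : NilRep n k} (h : IsoRep A B) (m : ℕ) (i : ZMod n) :
    A.rk m i = B.rk m i := by
  obtain ⟨e, he⟩ := h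
  have : range ((B.t ^ m) ∘ₗ B.pr i) = (range ((A.t ^ m) ∘ₗ A.pr i)).map (e : A.M →ₗ[k] B.M) := by
    ext b
    constructor
    · rintro ⟨c, rfl⟩
      refine ⟨_, ⟨e.symm c, rfl⟩, ?_⟩
      rw [LinearMap.comp_apply, he.pow_t_apply, he.pr_apply]
      simp
    · rintro ⟨_, ⟨a, rfl⟩, rfl⟩
      refine ⟨e a, ?_⟩
      rw [LinearMap.comp_apply, LinearMap.comp_apply, he.pow_t_apply, he.pr_apply]
      rfl
  rw [NilRep.rk, NilRep.rk, this]
  exact (LinearEquiv.finrank_map_eq e _).symm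


theorem IsoRep.homDim_eq {X Y : NilRep n k} (h : IsoRep X Y) (A : NilRep n k) :
    homDim A X = homDim A Y := by
  obtain ⟨e, he⟩ := h
  refine LinearEquiv.finrank_eq (LinearEquiv.ofLinearMap
    ((LinearEquiv.congrRight (M := A.M) e).toLinearMap.restrict
      (p := HomSub A X) (q := HomSub A Y) fun f hf => he.comp hf)
    ((LinearEquiv.congrRight (M := A.M) e.symm).toLinearMap.restrict
      (p := HomSub A Y) (q := HomSub A X) fun f hf => he.symm.comp hf) ?_ ?_)
  · ext f a
    exact e.apply_symm_apply (f.1 a)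
  · ext f a
    exact e.symm_apply_apply (f.1 a)

theorem LinearMap.pi_comp_proj_pow {ι : Type*} {V : ι → Type*} [∀ a, AddCommGroup (V a)]
    [∀ a, Module k (V a)] (T : ∀ a, V a →ₗ[k] V a) (m : ℕ) :
    (LinearMap.pi fun a => T a ∘ₗ LinearMap.proj a) ^ m =
      LinearMap.pi fun a => (T a ^ m) ∘ₗ LinearMap.proj a := by
  induction m with
  | zero => rfl
  | succ m ih =>
    rw [pow_succ, ih]
    ext v a
    simp [pow_succ]

namespace NilRep

/-- The direct sum of a finite family of representations. -/
@[reducible] def piRep {ι : Type} [Fintype ι] (X : ι → NilRep n k) : NilRep n k where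
  M := ∀ a, (X a).M
  pr i := LinearMap.pi fun a => (X a).pr i ∘ₗ LinearMap.proj a
  t := LinearMap.pi fun a => (X a).t ∘ₗ LinearMap.proj a
  idem i j := by
    refine LinearMap.ext fun v => funext fun a => ?_
    simp only [LinearMap.comp_apply, LinearMap.pi_apply, LinearMap.proj_apply, pr_pr]
    split_ifs <;> rfl
  sum := by
    refine LinearMap.ext fun v => funext fun a => ?_
    simp [LinearMap.sum_apply, sum_pr]
  comm i := by
    refine LinearMap.ext fun v => funext fun a => ?_
    simp [t_pr]
  nil := by
    choose m hm using fun a => (X a).nil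
    refine ⟨∑ a, m a, ?_⟩
    rw [LinearMap.pi_comp_proj_pow]
    refine LinearMap.ext fun v => funext fun a => ?_
    have : (X a).t ^ (∑ a, m a) = 0 :=
      pow_eq_zero_of_le (Finset.single_le_sum (f := m) (fun _ _ => Nat.zero_le _)
        (Finset.mem_univ a)) (hm a)
    simp [this]

variable {ι : Type} [Fintype ι]

theorem rk_piRep (X : ι → NilRep n k) (m : ℕ) (i : ZMod n) :
    (piRep X).rk m i = ∑ a, (X a).rk m i := by
  classical
  have happ : ∀ v : ∀ a, (X a).M, ∀ a, ((((piRep X).t ^ m) ∘ₗ (piRep X).pr i) v : ∀ a, (X a).M) a =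
      (((X a).t ^ m) ∘ₗ (X a).pr i) (v a) := by
    intro v a
    have := LinearMap.pi_comp_proj_pow (fun a => (X a).t) m
    rw [LinearMap.comp_apply]
    change ((LinearMap.pi fun a => (X a).t ∘ₗ LinearMap.proj a) ^ m) _ a = _
    rw [this]
    rfl
  unfold rk
  rw [← Module.finrank_pi_fintype]
  refine LinearEquiv.finrank_eq (LinearEquiv.ofBijective
    (LinearMap.pi fun a => ((LinearMap.proj a : (∀ a, (X a).M) →ₗ[k] (X a).M).restrict
      (p := range (((piRep X).t ^ m) ∘ₗ (piRep X).pr i))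
      (q := range (((X a).t ^ m) ∘ₗ (X a).pr i)) ?_)) ⟨?_, ?_⟩)
  · rintro _ ⟨v, rfl⟩
    exact ⟨v a, (happ v a).symm⟩
  · intro v w h
    refine Subtype.ext (funext fun a => ?_)
    exact congrArg Subtype.val (congrFun h a)
  · intro w
    choose v hv using fun a => (w a).2
    refine ⟨⟨_, ⟨v, rfl⟩⟩, funext fun a => Subtype.ext ?_⟩
    exact (happ v a).trans (hv a)

theorem isRepHom_pi {A : NilRep n k} {X : ι → NilRep n k} {f : ∀ a, A.M →ₗ[k] (X a).M}
    (hf : ∀ a, IsRepHom A (X a) (f a)) : IsRepHom A (piRep X) (LinearMap.pi f) :=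
  ⟨fun i => LinearMap.ext fun v => funext fun a => (hf a).pr_apply i v,
    LinearMap.ext fun v => funext fun a => (hf a).t_apply v⟩

theorem isRepHom_proj (X : ι → NilRep n k) (a : ι) :
    IsRepHom (piRep X) (X a) (LinearMap.proj a) := ⟨fun _ => rfl, rfl⟩

theorem homDim_piRep (A : NilRep n k) (X : ι → NilRep n k) :
    homDim A (piRep X) = ∑ a, homDim A (X a) := by
  unfold homDim
  rw [← Module.finrank_pi_fintype]
  refine LinearEquiv.finrank_eq (LinearEquiv.ofBijective
    (LinearMap.pi fun a => (LinearMap.compRight k (M := A.M)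
      (LinearMap.proj a : (∀ a, (X a).M) →ₗ[k] (X a).M)).restrict
      (p := HomSub A (piRep X)) (q := HomSub A (X a))
      fun f hf => (isRepHom_proj X a).comp hf) ⟨?_, ?_⟩)
  · intro f g h
    refine Subtype.ext (LinearMap.ext fun v => funext fun a => ?_)
    exact LinearMap.congr_fun (congrArg Subtype.val (congrFun h a)) v
  · intro w
    exact ⟨⟨LinearMap.pi fun a => (w a).1, isRepHom_pi fun a => (w a).2⟩, rfl⟩

theorem isExtensionOf_piRep {C A B : ι → NilRep n k} (h : ∀ a, IsExtensionOf (C a) (A a) (B a)) :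
    IsExtensionOf (piRep C) (piRep A) (piRep B) := by
  choose f g hf hg hfi hgs hfg using h
  refine ⟨LinearMap.pi fun a => f a ∘ₗ LinearMap.proj a, LinearMap.pi fun a => g a ∘ₗ LinearMap.proj a,
    isRepHom_pi fun a => (hf a).comp (isRepHom_proj B a),
    isRepHom_pi fun a => (hg a).comp (isRepHom_proj C a), ?_, ?_, ?_⟩
  · intro v w h
    exact funext fun a => hfi a (congrFun h a)
  · intro w
    choose v hv using fun a => hgs a (w a)
    exact ⟨v, funext hv⟩
  · ext v
    have hmem : ∀ a, v a ∈ range (f a) ↔ v a ∈ ker (g a) := fun a => by rw [hfg a]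
    constructor
    · rintro ⟨w, rfl⟩
      exact funext fun a => (hmem a).1 ⟨w a, rfl⟩
    · intro hv
      choose w hw using fun a => (hmem a).2 (congrFun hv a)
      exact ⟨w, funext hw⟩

end NilRep

theorem IsExtensionOf.of_iso {C A B A' B' : NilRep n k} (h : IsExtensionOf C A B)
    (hA : IsoRep A A') (hB : IsoRep B B') : IsExtensionOf C A' B' := by
  obtain ⟨f, g, hf, hg, hfi, hgs, hfg⟩ := h
  obtain ⟨a, ha⟩ := hA
  obtain ⟨b, hb⟩ := hB
  refine ⟨f ∘ₗ (b.symm : B'.M →ₗ[k] B.M), (a : A.M →ₗ[k] A'.M) ∘ₗ g, hf.comp hb.symm, ha.comp hg,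
    hfi.comp b.symm.injective, a.surjective.comp hgs, ?_⟩
  rw [LinearMap.range_comp, LinearEquiv.range, Submodule.map_top, hfg, LinearEquiv.ker_comp]

section extension

variable {C A B : NilRep n k}

theorem IsExtensionOf.dimAt_eq (h : IsExtensionOf C A B) (i : ZMod n) :
    dimAt C i = dimAt A i + dimAt B i := by
  obtain ⟨f, g, hf, hg, hfi, hgs, hfg⟩ := h
  have h1 := (g.domRestrict (range (C.pr i))).finrank_range_add_finrank_ker
  have h2 : range (g.domRestrict (range (C.pr i))) = range (A.pr i) := by
    ext y
    constructor
    · rintro ⟨⟨_, c, rfl⟩, rfl⟩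
      exact ⟨g c, (hg.pr_apply i c).symm⟩
    · rintro ⟨a, rfl⟩
      obtain ⟨c, rfl⟩ := hgs a
      exact ⟨⟨_, c, rfl⟩, hg.pr_apply i c⟩
  have h3 : finrank k (ker (g.domRestrict (range (C.pr i)))) = dimAt B i := by
    have e1 : (ker (g.domRestrict (range (C.pr i)))).map (range (C.pr i)).subtype =
        (range (B.pr i)).map f := by
      ext y
      constructor
      · rintro ⟨⟨_, c, rfl⟩, hc, rfl⟩
        have : C.pr i c ∈ range f := by
          rw [hfg]
          exact hc
        obtain ⟨b, hb⟩ := this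
        refine ⟨B.pr i b, ⟨b, rfl⟩, ?_⟩
        rw [hf.pr_apply, hb, NilRep.pr_pr_self]
        rfl
      · rintro ⟨_, ⟨b, rfl⟩, rfl⟩
        refine ⟨⟨f (B.pr i b), f b, (hf.pr_apply i b).symm⟩, ?_, rfl⟩
        have : f (B.pr i b) ∈ ker g := by
          rw [← hfg]
          exact ⟨_, rfl⟩
        exact this
    rw [← Submodule.finrank_map_subtype_eq, e1]
    exact (Submodule.equivMapOfInjective f hfi _).finrank_eq.symm
  rw [h2, h3] at h1
  exact h1.symm

theorem IsExtensionOf.rk_le (h : IsExtensionOf C A B) (p q : ℕ) (i : ZMod n) :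
    C.rk (p + q) i ≤ A.rk p i + B.rk q (i + p) := by
  obtain ⟨f, g, hf, hg, hfi, hgs, hfg⟩ := h
  set V := range ((C.t ^ p) ∘ₗ C.pr i) with hV
  have e1 : C.rk (p + q) i = finrank k (V.map (C.t ^ q)) := by
    rw [NilRep.rk, hV, ← LinearMap.range_comp, ← LinearMap.comp_assoc, add_comm p q, pow_add]
    rfl
  have e2 : A.rk p i = finrank k (V.map g) := by
    have : V.map g = range ((A.t ^ p) ∘ₗ A.pr i) := by
      ext y
      constructor
      · rintro ⟨_, ⟨c, rfl⟩, rfl⟩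
        refine ⟨g c, ?_⟩
        simp only [LinearMap.comp_apply, hg.pow_t_apply, hg.pr_apply]
      · rintro ⟨a, rfl⟩
        obtain ⟨c, rfl⟩ := hgs a
        refine ⟨_, ⟨c, rfl⟩, ?_⟩
        simp only [LinearMap.comp_apply, hg.pow_t_apply, hg.pr_apply]
    rw [this, NilRep.rk]
  have e3 : finrank k ((V ⊓ ker g : Submodule k C.M).map (C.t ^ q)) ≤ B.rk q (i + p) := by
    have hle : (V ⊓ ker g : Submodule k C.M).map (C.t ^ q) ≤
        (range ((B.t ^ q) ∘ₗ B.pr (i + p))).map f := by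
      rintro _ ⟨_, ⟨⟨c, rfl⟩, hc⟩, rfl⟩
      rw [← hfg] at hc
      obtain ⟨b, hb⟩ := hc
      refine ⟨_, ⟨b, rfl⟩, ?_⟩
      rw [LinearMap.comp_apply, hf.pow_t_apply, hf.pr_apply, hb, LinearMap.comp_apply,
        C.pow_t_pr p, NilRep.pr_pr_self]
    refine (Submodule.finrank_mono hle).trans ?_
    exact Submodule.finrank_map_le _ _
  have key : ∀ (W : Submodule k C.M) {Y : Type} [AddCommGroup Y] [Module k Y] (φ : C.M →ₗ[k] Y),
      finrank k (W.map φ) + finrank k (W ⊓ ker φ : Submodule k C.M) = finrank k W := by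
    intro W Y _ _ φ
    have := (φ.domRestrict W).finrank_range_add_finrank_ker
    rw [LinearMap.range_domRestrict, LinearMap.ker_domRestrict] at this
    rw [← this, ← Submodule.finrank_map_subtype_eq W (Submodule.comap _ _),
      Submodule.map_comap_subtype]
  have k1 := key V g
  have k2 := key V (C.t ^ q)
  have k3 := key (V ⊓ ker g) (C.t ^ q)
  have k4 : finrank k ((V ⊓ ker g) ⊓ ker (C.t ^ q) : Submodule k C.M) ≤
      finrank k (V ⊓ ker (C.t ^ q) : Submodule k C.M) :=
    Submodule.finrank_mono (inf_le_inf_right _ inf_le_left)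
  omega

end extension

namespace NilRep

/-- The uniserial representation of length `l` with socle at the vertex `j`: the coordinate `s`
sits at the vertex `j - s`, and `t` shifts the coordinates down. -/
@[reducible] def uni (j : ZMod n) (l : ℕ) : NilRep n k where
  M := Fin l → k
  pr i := LinearMap.pi fun s => if i + (s : ℕ) = j then LinearMap.proj s else 0
  t := LinearMap.pi fun s => if h : (s : ℕ) + 1 < l then LinearMap.proj ⟨s + 1, h⟩ else 0
  idem i i' := by
    refine LinearMap.ext fun v => funext fun s => ?_
    simp only [LinearMap.comp_apply, LinearMap.pi_apply]
    by_cases h : i = i'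
    · subst h
      by_cases h' : i + (s : ℕ) = j <;> simp [h']
    · by_cases h' : i + (s : ℕ) = j
      · have : ¬ i' + (s : ℕ) = j := fun h'' => h (add_right_cancel (h'.trans h''.symm))
        simp [h, h', this]
      · simp [h, h']
  sum := by
    refine LinearMap.ext fun v => funext fun s => ?_
    rw [LinearMap.sum_apply, Finset.sum_apply, Finset.sum_eq_single (j - (s : ℕ))]
    · simp
    · intro i _ hi
      have : ¬ i + (s : ℕ) = j := fun h => hi (eq_sub_of_add_eq h)
      simp [this]
    · simp
  comm i := by
    refine LinearMap.ext fun v => funext fun s => ?_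
    simp only [LinearMap.comp_apply, LinearMap.pi_apply]
    have e : i + (((s : ℕ) : ZMod n) + 1) = i + 1 + (s : ℕ) := by ring
    by_cases h : (s : ℕ) + 1 < l
    · by_cases h' : i + 1 + (s : ℕ) = j
      · simp [h, h', e]
      · simp [h, h', e]
    · by_cases h' : i + 1 + (s : ℕ) = j <;> simp [h, h']
  nil := by
    refine ⟨l, LinearMap.ext fun v => ?_⟩
    have : ∀ c : ℕ, ∀ s : Fin l, l ≤ s + c → ((LinearMap.pi fun s : Fin l =>
        if h : (s : ℕ) + 1 < l then LinearMap.proj ⟨s + 1, h⟩ else (0 : (Fin l → k) →ₗ[k] k)) ^ c) v s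
          = 0 := by
      intro c
      induction c with
      | zero =>
        intro s hs
        omega
      | succ c ih =>
        intro s hs
        rw [pow_succ', End.mul_apply, LinearMap.pi_apply]
        split_ifs with h
        · exact ih ⟨s + 1, h⟩ (by simp only; omega)
        · rfl
    exact funext fun s => this l s (by omega)

theorem uni_pr_apply (j : ZMod n) (l : ℕ) (i : ZMod n) (v : Fin l → k) (s : Fin l) :
    ((uni j l : NilRep n k).pr i v : Fin l → k) s = if i + (s : ℕ) = j then v s else 0 := by
  simp only [LinearMap.pi_apply]
  split_ifs <;> rfl

theorem uni_t_apply (j : ZMod n) (l : ℕ) (v : Fin l → k) (s : Fin l) :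
    ((uni j l : NilRep n k).t v : Fin l → k) s =
      if h : (s : ℕ) + 1 < l then v ⟨s + 1, h⟩ else 0 := by
  simp only [LinearMap.pi_apply]
  split_ifs <;> rfl

theorem uni_pow_t_apply (j : ZMod n) (l c : ℕ) (v : Fin l → k) (s : Fin l) :
    (((uni j l : NilRep n k).t ^ c) v : Fin l → k) s =
      if h : (s : ℕ) + c < l then v ⟨s + c, h⟩ else 0 := by
  induction c generalizing s with
  | zero => simp
  | succ c ih =>
    rw [pow_succ', End.mul_apply, uni_t_apply]
    split_ifs with h1 h2 h2
    · rw [ih, dif_pos (by simp only; omega)]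
      congr 2
      simp only
      omega
    · rw [ih, dif_neg (by simp only; omega)]
    · omega
    · rfl

/-- The subspace of `A` on which the socle coordinate of a morphism to `uni j l` vanishes. -/
def socKer (A : NilRep n k) (j : ZMod n) (l : ℕ) : Submodule k A.M :=
  range (A.t ^ l) ⊔ ker (A.pr j)

theorem finrank_socKer (A : NilRep n k) (j : ZMod n) (l : ℕ) :
    finrank k (A.socKer j l) + dimAt A j = A.rk l (j - l) + finrank k A.M := by
  have h1 := ((A.pr j).domRestrict (A.socKer j l)).finrank_range_add_finrank_ker
  have h2 := (A.pr j).finrank_range_add_finrank_ker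
  rw [LinearMap.range_domRestrict, LinearMap.ker_domRestrict,
    ← Submodule.finrank_map_subtype_eq (A.socKer j l) (Submodule.comap _ _),
    Submodule.map_comap_subtype, inf_eq_right.2 (show ker (A.pr j) ≤ A.socKer j l from le_sup_right)] at h1
  have h3 : (A.socKer j l).map (A.pr j) = range ((A.t ^ l) ∘ₗ A.pr (j - l)) := by
    rw [socKer, Submodule.map_sup, LinearMap.le_ker_iff_map.1 (le_refl (ker (A.pr j))), sup_bot_eq,
      ← LinearMap.range_comp]
    congr 1
    ext a
    rw [LinearMap.comp_apply, LinearMap.comp_apply, A.pow_t_pr, sub_add_cancel]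
  rw [h3] at h1
  rw [dimAt, rk]
  omega

theorem mem_dualAnnihilator_socKer {A : NilRep n k} {j : ZMod n} {l : ℕ} {g : Dual k A.M} :
    g ∈ (A.socKer j l).dualAnnihilator ↔ (∀ a, g ((A.t ^ l) a) = 0) ∧ ∀ a, g (A.pr j a) = g a := by
  rw [Submodule.mem_dualAnnihilator]
  constructor
  · intro h
    refine ⟨fun a => h _ (Submodule.mem_sup_left ⟨a, rfl⟩), fun a => ?_⟩
    have := h (A.pr j a - a) (Submodule.mem_sup_right (by simp [pr_pr_self]))
    rwa [map_sub, sub_eq_zero] at this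
  · rintro ⟨h1, h2⟩ w hw
    obtain ⟨_, ⟨a, rfl⟩, b, hb, rfl⟩ := Submodule.mem_sup.1 hw
    rw [map_add, h1, ← h2 b, LinearMap.mem_ker.1 hb, map_zero, add_zero]

/-- The morphism to a uniserial representation with prescribed socle coordinate. -/
def toUni (A : NilRep n k) (l : ℕ) (g : Dual k A.M) : A.M →ₗ[k] (Fin l → k) :=
  LinearMap.pi fun s => g ∘ₗ (A.t ^ (s : ℕ))

theorem toUni_apply (A : NilRep n k) (l : ℕ) (g : Dual k A.M) (a : A.M) (s : Fin l) :
    A.toUni l g a s = g ((A.t ^ (s : ℕ)) a) := rfl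

theorem isRepHom_toUni {A : NilRep n k} {j : ZMod n} {l : ℕ} {g : Dual k A.M}
    (h1 : ∀ a, g ((A.t ^ l) a) = 0) (h2 : ∀ a, g (A.pr j a) = g a) :
    IsRepHom A (uni j l) (A.toUni l g) := by
  constructor
  · intro i
    refine LinearMap.ext fun a => funext fun s => ?_
    rw [LinearMap.comp_apply, LinearMap.comp_apply, uni_pr_apply, toUni_apply, toUni_apply,
      pow_t_pr, ← h2, pr_pr]
    split_ifs with h h' h'
    · rw [h2]
    · exact absurd h.symm h'
    · exact absurd h'.symm h
    · exact map_zero g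
  · refine LinearMap.ext fun a => funext fun s => ?_
    rw [LinearMap.comp_apply, LinearMap.comp_apply, uni_t_apply, toUni_apply, ← End.mul_apply,
      ← pow_succ]
    split_ifs with h
    · rfl
    · have : (s : ℕ) + 1 = l := by omega
      rw [this, h1]

theorem eq_toUni {A : NilRep n k} {j : ZMod n} {l : ℕ} {f : A.M →ₗ[k] (Fin (l + 1) → k)}
    (hf : IsRepHom A (uni j (l + 1)) f) : f = A.toUni (l + 1) (LinearMap.proj 0 ∘ₗ f) := by
  refine LinearMap.ext fun a => funext fun s => ?_
  have h : f ((A.t ^ (s : ℕ)) a) = ((uni j (l + 1) : NilRep n k).t ^ (s : ℕ)) (f a) :=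
    hf.pow_t_apply s a
  rw [toUni_apply, LinearMap.comp_apply, h, LinearMap.proj_apply, uni_pow_t_apply,
    dif_pos (by simp; omega)]
  exact congrArg (f a) (Fin.ext (by simp))

theorem homDim_uni (A : NilRep n k) (j : ZMod n) (l : ℕ) :
    homDim A (uni j l) + A.rk l (j - l) = dimAt A j := by
  cases l with
  | zero =>
    have : homDim A (uni j 0) = 0 := by
      have : Subsingleton (HomSub A (uni j 0)) :=
        ⟨fun f g => Subtype.ext (LinearMap.ext fun a => funext fun s => s.elim0)⟩
      exact finrank_zero_of_subsingleton
    rw [this, Nat.cast_zero, sub_zero, rk_zero, zero_add]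
  | succ l =>
    have h1 := Subspace.finrank_add_finrank_dualAnnihilator_eq (A.socKer j (l + 1))
    have h2 := A.finrank_socKer j (l + 1)
    have h3 : homDim A (uni j (l + 1)) = finrank k (A.socKer j (l + 1)).dualAnnihilator := by
      refine LinearEquiv.finrank_eq (LinearEquiv.ofBijective
        ((LinearMap.compRight k (M := A.M)
          (LinearMap.proj 0 : (Fin (l + 1) → k) →ₗ[k] k)).restrict
          (p := HomSub A (uni j (l + 1))) (q := (A.socKer j (l + 1)).dualAnnihilator) ?_) ⟨?_, ?_⟩)
      · intro f (hf : IsRepHom A (uni j (l + 1)) f)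
        rw [mem_dualAnnihilator_socKer]
        constructor
        · intro a
          have h : f ((A.t ^ (l + 1)) a) = ((uni j (l + 1) : NilRep n k).t ^ (l + 1)) (f a) :=
            hf.pow_t_apply _ a
          change f ((A.t ^ (l + 1)) a) 0 = 0
          rw [h, uni_pow_t_apply, dif_neg (by simp)]
        · intro a
          have h : f (A.pr j a) = (uni j (l + 1) : NilRep n k).pr j (f a) := hf.pr_apply _ a
          change f (A.pr j a) 0 = f a 0
          rw [h, uni_pr_apply, if_pos (by simp)]
      · intro f g h
        have h' : LinearMap.proj 0 ∘ₗ f.1 = LinearMap.proj 0 ∘ₗ g.1 := congrArg Subtype.val h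
        exact Subtype.ext ((eq_toUni f.2).trans ((congrArg _ h').trans (eq_toUni g.2).symm))
      · rintro ⟨g, hg⟩
        rw [mem_dualAnnihilator_socKer] at hg
        exact ⟨⟨_, isRepHom_toUni hg.1 hg.2⟩, rfl⟩
    omega

end NilRep

theorem DegLe.rk_le {A B : NilRep n k} (h : DegLe A B) (m : ℕ) (i : ZMod n) :
    A.rk m i ≤ B.rk m i := by
  have h1 := A.homDim_uni (i + m) m
  have h2 := B.homDim_uni (i + m) m
  have h3 := h.1 (i + m)
  have h4 := h.2 (NilRep.uni (i + m) m)
  rw [add_sub_cancel_right] at h1 h2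
  omega

namespace NilRep

/-- The restriction of a representation to an invariant subspace. -/
@[reducible] def subRep (A : NilRep n k) (p : Submodule k A.M) (hpr : ∀ i, ∀ x ∈ p, A.pr i x ∈ p)
    (ht : ∀ x ∈ p, A.t x ∈ p) : NilRep n k where
  M := p
  pr i := (A.pr i).restrict (hpr i)
  t := A.t.restrict ht
  idem i j := by
    refine LinearMap.ext fun x => Subtype.ext ?_
    have := A.pr_pr i j x
    split_ifs at this ⊢ <;> exact this
  sum := by
    refine LinearMap.ext fun x => Subtype.ext ?_
    have := A.sum_pr x
    simpa [LinearMap.sum_apply] using this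
  comm i := LinearMap.ext fun x => Subtype.ext (A.t_pr i x)
  nil := by
    obtain ⟨r, hr⟩ := A.nil
    refine ⟨r, LinearMap.ext fun x => Subtype.ext ?_⟩
    rw [Module.End.pow_restrict r ht, LinearMap.coe_restrict_apply, hr]
    rfl

/-- The kernel of a morphism of representations. -/
@[reducible] def kerRep {A B : NilRep n k} (f : A.M →ₗ[k] B.M) (hf : IsRepHom A B f) :
    NilRep n k :=
  A.subRep (ker f)
    (fun i x hx => by rw [LinearMap.mem_ker, hf.pr_apply, LinearMap.mem_ker.1 hx, map_zero])
    (fun x hx => by rw [LinearMap.mem_ker, hf.t_apply, LinearMap.mem_ker.1 hx, map_zero])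

theorem exists_pr_ne_zero {A B : NilRep n k} {T : A.M →ₗ[k] B.M} (hT : T ≠ 0) :
    ∃ (i : ZMod n) (x : A.M), A.pr i x = x ∧ T x ≠ 0 := by
  by_contra! h
  refine hT (LinearMap.ext fun a => ?_)
  rw [← A.sum_pr a, map_sum]
  exact Finset.sum_eq_zero fun i _ => h i _ (A.pr_pr_self i a)

/-- A nonzero representation surjects onto a uniserial representation, and this surjection
has a section. -/
theorem exists_uni_retract (A : NilRep n k) (hA : finrank k A.M ≠ 0) :
    ∃ (j : ZMod n) (l : ℕ) (f : A.M →ₗ[k] (Fin (l + 1) → k)) (g : (Fin (l + 1) → k) →ₗ[k] A.M),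
      IsRepHom A (uni j (l + 1)) f ∧ IsRepHom (uni j (l + 1)) A g ∧ ∀ v, f (g v) = v := by
  classical
  obtain ⟨l, hl0, hl1⟩ : ∃ l, A.t ^ l ≠ 0 ∧ A.t ^ (l + 1) = 0 := by
    have hpos : Nat.find A.nil ≠ 0 := by
      intro h0
      have h1 := Nat.find_spec A.nil
      rw [h0, pow_zero] at h1
      have : Subsingleton A.M :=
        ⟨fun a b => by rw [← End.one_apply (R := k) a, ← End.one_apply (R := k) b, h1]; rfl⟩
      exact hA finrank_zero_of_subsingleton
    refine ⟨Nat.find A.nil - 1, Nat.find_min A.nil (by omega), ?_⟩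
    rw [Nat.sub_add_cancel (by omega)]
    exact Nat.find_spec A.nil
  have hzero : ∀ c, l < c → A.t ^ c = 0 := fun c hc => pow_eq_zero_of_le hc hl1
  obtain ⟨i, x, hix, hx⟩ := exists_pr_ne_zero hl0
  have hli := linearIndependent_pow_apply A.nil hx
  obtain ⟨F, hF⟩ : ∃ F : Dual k A.M, ∀ c : Fin (l + 1),
      F ((A.t ^ (c : ℕ)) x) = if (c : ℕ) = l then 1 else 0 := by
    obtain ⟨G, hG⟩ := LinearMap.exists_leftInverse_of_injective
      (Fintype.linearCombination k fun c : Fin (l + 1) => (A.t ^ (c : ℕ)) x)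
      (LinearMap.ker_eq_bot.2 (linearIndependent_iff_injective_fintypeLinearCombination.1 hli))
    refine ⟨LinearMap.proj (Fin.last l) ∘ₗ G, fun c => ?_⟩
    have h1 := LinearMap.congr_fun hG (Pi.single c 1)
    rw [LinearMap.comp_apply, Fintype.linearCombination_apply_single, one_smul] at h1
    rw [LinearMap.comp_apply, h1, LinearMap.id_apply, LinearMap.proj_apply, Pi.single_apply]
    exact if_congr (by rw [Fin.ext_iff, Fin.val_last, eq_comm]) rfl rfl
  set j : ZMod n := i + l with hj
  have hpow : ∀ c, F (A.pr j ((A.t ^ c) x)) = if c = l then 1 else 0 := by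
    intro c
    rcases lt_trichotomy c l with h | h | h
    · rw [← hix, A.pow_t_pr, A.pr_pr]
      split_ifs with h1 h2 h2
      · omega
      · rw [h1, ← A.pow_t_pr, hix, hF ⟨c, by omega⟩, if_neg h2]
      · omega
      · exact map_zero F
    · subst h
      rw [hj, ← A.pow_t_pr, hix, hF ⟨c, by omega⟩]
    · rw [hzero c h, if_neg (by omega)]
      simp
  have hf : IsRepHom A (uni j (l + 1)) (A.toUni (l + 1) (F ∘ₗ A.pr j)) :=
    isRepHom_toUni (fun a => by rw [hl1]; simp) fun a => by
      rw [LinearMap.comp_apply, LinearMap.comp_apply, A.pr_pr_self]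
  let g : (Fin (l + 1) → k) →ₗ[k] A.M :=
    ∑ s : Fin (l + 1), (LinearMap.proj s).smulRight ((A.t ^ (l - (s : ℕ))) x)
  have hg : ∀ v, g v = ∑ s : Fin (l + 1), v s • (A.t ^ (l - (s : ℕ))) x := fun v => by
    simp [g, LinearMap.sum_apply]
  refine ⟨j, l, _, g, hf, ⟨fun i' => ?_, ?_⟩, fun v => ?_⟩
  · refine LinearMap.ext fun v => ?_
    rw [LinearMap.comp_apply, LinearMap.comp_apply, hg, hg, map_sum]
    refine Finset.sum_congr rfl fun s _ => ?_
    have hs : (A.t ^ (l - (s : ℕ))) x = A.pr (j - (s : ℕ)) ((A.t ^ (l - (s : ℕ))) x) := by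
      have := A.pow_t_pr (l - s) i x
      rw [hix] at this
      have hc : i + ((l - (s : ℕ) : ℕ) : ZMod n) = j - (s : ℕ) := by
        rw [Nat.cast_sub (by omega), hj]
        ring
      rwa [hc] at this
    rw [uni_pr_apply, map_smul, hs, A.pr_pr]
    by_cases h : i' + (s : ℕ) = j
    · rw [if_pos h, if_pos (eq_sub_of_add_eq h), ← eq_sub_of_add_eq h]
    · rw [if_neg h, if_neg fun h' => h (by rw [h', sub_add_cancel]), zero_smul, smul_zero]
  · refine LinearMap.ext fun v => ?_
    rw [LinearMap.comp_apply, LinearMap.comp_apply, hg, hg, map_sum, Fin.sum_univ_castSucc,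
      Fin.sum_univ_succ]
    have e1 : A.t (v 0 • (A.t ^ (l - ((0 : Fin (l + 1)) : ℕ))) x) = 0 := by
      rw [map_smul, ← End.mul_apply, ← pow_succ', Fin.val_zero, Nat.sub_zero, hl1]
      simp
    have e2 : ((uni j (l + 1) : NilRep n k).t v : Fin (l + 1) → k) (Fin.last l) = 0 := by
      rw [uni_t_apply, dif_neg (by simp)]
    rw [e1, e2, zero_smul, add_zero, zero_add]
    refine Finset.sum_congr rfl fun s _ => ?_
    rw [uni_t_apply, dif_pos (by simp), map_smul, ← End.mul_apply, ← pow_succ']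
    have : l - (s.succ : ℕ) + 1 = l - (s.castSucc : ℕ) := by simp; omega
    rw [this]
    rfl
  · refine funext fun s => ?_
    have hadd : ∀ r : ℕ, (A.t ^ (s : ℕ)) ((A.t ^ (l - r)) x) = (A.t ^ (s + (l - r))) x :=
      fun r => by rw [pow_add, End.mul_apply]
    rw [toUni_apply, hg, map_sum, LinearMap.comp_apply, map_sum, map_sum,
      Finset.sum_eq_single s]
    · rw [map_smul, map_smul, map_smul, hadd, hpow, if_pos (by omega), smul_eq_mul, mul_one]
    · intro r _ hr
      have : (r : ℕ) ≠ s := fun h => hr (Fin.ext h)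
      rw [map_smul, map_smul, map_smul, hadd, hpow, if_neg (by omega), smul_zero]
    · simp

/-- Every representation is a finite direct sum of uniserial ones. -/
theorem exists_iso_piRep (A : NilRep n k) : ∃ (ι : Type) (_ : Fintype ι) (s : ι → ZMod n × ℕ),
    IsoRep A (piRep fun a => uni (s a).1 (s a).2) := by
  induction hd : finrank k A.M using Nat.strong_induction_on generalizing A with
  | _ d ih =>
    by_cases hA : finrank k A.M = 0
    · refine ⟨Empty, inferInstance, Empty.elim, IsoRep.of_bijective
        (isRepHom_pi (f := fun a => a.elim) fun a => a.elim) ⟨?_, ?_⟩⟩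
      · have : Subsingleton A.M := finrank_zero_iff.1 hA
        exact fun a b _ => Subsingleton.elim a b
      · exact fun v => ⟨0, funext fun a => a.elim⟩
    · obtain ⟨j, l, f, g, hf, hg, hfg⟩ := A.exists_uni_retract hA
      have hsurj : Function.Surjective f := fun v => ⟨g v, hfg v⟩
      have hlt : finrank k (kerRep (B := uni j (l + 1)) f hf).M < d := by
        have h1 := f.finrank_range_add_finrank_ker
        rw [LinearMap.range_eq_top.2 hsurj, finrank_top, finrank_fin_fun] at h1
        rw [← hd]
        change finrank k (ker f) < _
        omega
      obtain ⟨ι, _, s, e, he⟩ := ih _ hlt (kerRep (B := uni j (l + 1)) f hf) rfl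
      let q : A.M →ₗ[k] (kerRep (B := uni j (l + 1)) f hf).M := (LinearMap.id - g ∘ₗ f).codRestrict (ker f)
        fun a => by simp [hfg]
      have hqa : ∀ a, ((q a : ker f) : A.M) = a - g (f a) := fun a => rfl
      have hq : IsRepHom A (kerRep (B := uni j (l + 1)) f hf) q := by
        refine ⟨fun i => LinearMap.ext fun a => Subtype.ext ?_,
          LinearMap.ext fun a => Subtype.ext ?_⟩
        · have h1 := hf.pr_apply i a
          have h2 := hg.pr_apply i (f a)
          change A.pr i a - g (f (A.pr i a)) = A.pr i (a - g (f a))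
          rw [h1, h2, map_sub]
        · have h1 := hf.t_apply a
          have h2 := hg.t_apply (f a)
          change A.t a - g (f (A.t a)) = A.t (a - g (f a))
          rw [h1, h2, map_sub]
      let s' : Option ι → ZMod n × ℕ := fun o => o.elim (j, l + 1) s
      let F : ∀ o, A.M →ₗ[k] (uni (s' o).1 (s' o).2 : NilRep n k).M := fun o => match o with
        | none => f
        | some a => (LinearMap.proj a : (∀ a, Fin (s a).2 → k) →ₗ[k] _) ∘ₗ
          (e : (kerRep (B := uni j (l + 1)) f hf).M →ₗ[k] _) ∘ₗ q
      have hF : ∀ o, IsRepHom A (uni (s' o).1 (s' o).2) (F o) := fun o => match o with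
        | none => hf
        | some a => (isRepHom_proj (fun a => uni (s a).1 (s a).2) a).comp (he.comp hq)
      refine ⟨Option ι, inferInstance, s', IsoRep.of_bijective (isRepHom_pi hF) ⟨?_, ?_⟩⟩
      · refine (injective_iff_map_eq_zero (LinearMap.pi F)).2 fun a ha => ?_
        have h1 : f a = 0 := congrFun ha none
        have h2 : e (q a) = 0 := funext fun b => congrFun ha (some b)
        have h3 : q a = 0 := e.injective (h2.trans (map_zero e).symm)
        have h4 := hqa a
        rw [h3, h1, map_zero, sub_zero] at h4
        exact h4.symm
      · intro v
        let w : Fin (l + 1) → k := v none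
        let z : ker f := e.symm fun b => v (some b)
        have hz : f (z : A.M) = 0 := z.2
        have hfz : f (g w + z) = w := by rw [map_add, hfg, hz, add_zero]
        refine ⟨g w + z, funext fun o => ?_⟩
        cases o with
        | none => exact hfz
        | some b =>
          have hqz : q (g w + z) = z := Subtype.ext (by rw [hqa, hfz]; abel)
          change e (q (g w + z)) b = _
          rw [hqz]
          exact congrFun (e.apply_symm_apply _) b

end NilRep

theorem degLe_of_rk_le {A B : NilRep n k} (h0 : ∀ i, dimAt A i = dimAt B i)
    (h : ∀ m i, A.rk m i ≤ B.rk m i) : DegLe A B := by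
  refine ⟨h0, fun X => ?_⟩
  obtain ⟨ι, _, s, hs⟩ := X.exists_iso_piRep
  rw [hs.homDim_eq, hs.homDim_eq, NilRep.homDim_piRep, NilRep.homDim_piRep]
  refine Finset.sum_le_sum fun a _ => ?_
  have h1 := A.homDim_uni (s a).1 (s a).2
  have h2 := B.homDim_uni (s a).1 (s a).2
  have h3 := h0 (s a).1
  have h4 := h (s a).2 ((s a).1 - (s a).2)
  omega

/-- Weak and strong duality for the assignment problem: optimal integral potentials are tight
along a perfect matching. -/
theorem exists_potential_perm {ι : Type*} [Fintype ι] (w : ι → ι → ℤ) :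
    ∃ (u v : ι → ℤ) (σ : Equiv.Perm ι), (∀ a b, w a b ≤ u a + v b) ∧
      ∀ a, u a + v (σ a) = w a (σ a) := by
  classical
  let P : ℕ → Prop := fun s => ∃ u v : ι → ℤ, (∀ a b, w a b ≤ u a + v b) ∧
    (s : ℤ) = ∑ a, (u a + v a - w a a)
  have hP : ∀ u v : ι → ℤ, (∀ a b, w a b ≤ u a + v b) →
      P (∑ a, (u a + v a - w a a)).toNat := fun u v h =>
    ⟨u, v, h, Int.toNat_of_nonneg (Finset.sum_nonneg fun a _ => by linarith [h a a])⟩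
  have hex : ∃ s, P s := by
    refine ⟨_, hP (fun a => ∑ b, |w a b|) 0 fun a b => ?_⟩
    rw [Pi.zero_apply, add_zero]
    exact (le_abs_self _).trans
      (Finset.single_le_sum (f := fun b => |w a b|) (fun _ _ => abs_nonneg _) (Finset.mem_univ b))
  obtain ⟨u, v, huv, hs⟩ := Nat.find_spec hex
  let T : ι → Finset ι := fun a => {b | u a + v b = w a b}
  have hall : ∀ S : Finset ι, S.card ≤ (S.biUnion T).card := by
    intro S
    by_contra! hlt
    let u' : ι → ℤ := fun a => u a - if a ∈ S then 1 else 0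
    let v' : ι → ℤ := fun b => v b + if b ∈ S.biUnion T then 1 else 0
    have huv' : ∀ a b, w a b ≤ u' a + v' b := by
      intro a b
      have h := huv a b
      simp only [u', v']
      split_ifs with h1 h2 h2
      · linarith
      · have : u a + v b ≠ w a b := fun h3 => h2 (Finset.mem_biUnion.2 ⟨a, h1, by simp [T, h3]⟩)
        omega
      · linarith
      · linarith
    have hsum : ∑ a, (u' a + v' a - w a a) =
        ∑ a, (u a + v a - w a a) - S.card + (S.biUnion T).card := by
      have h1 : (S.card : ℤ) = ∑ a, if a ∈ S then 1 else 0 := by simp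
      have h2 : ((S.biUnion T).card : ℤ) = ∑ a, if a ∈ S.biUnion T then 1 else 0 := by
        rw [Finset.sum_ite_mem, Finset.univ_inter, Finset.sum_const, nsmul_one]
      rw [h1, h2, ← Finset.sum_sub_distrib, ← Finset.sum_add_distrib]
      refine Finset.sum_congr rfl fun a _ => ?_
      simp only [u', v']
      ring
    refine Nat.find_min hex ?_ (hP u' v' huv')
    rw [hsum, ← hs]
    have : 0 ≤ ∑ a, (u' a + v' a - w a a) :=
      Finset.sum_nonneg fun a _ => by linarith [huv' a a]
    omega
  obtain ⟨f, hf, hfT⟩ := (Finset.all_card_le_biUnion_card_iff_exists_injective T).1 hall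
  refine ⟨u, v, Equiv.ofBijective f (Finite.injective_iff_bijective.1 hf), huv, fun a => ?_⟩
  simpa [T] using hfT a

theorem exists_potential_shift {ι : Type*} [Fintype ι] {n m : ℕ} (hn : 0 < n) (x y : ι → ℤ)
    (h : ∀ σ : Equiv.Perm ι, ∃ a, x a = 0 ∧ y (σ a) = m) :
    ∃ (σ : Equiv.Perm ι) (u v : ι → ℕ) (p : ℕ), p ≤ m ∧ (∀ a, x a - p ≤ n * u a) ∧
      (∀ b, p - y b ≤ n * v b) ∧
      ∀ a, u a + v (σ a) = 0 ∨ n * (u a + v (σ a) - 1 : ℤ) < x a - y (σ a) := by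
  classical
  let W : ℤ → ℤ → ℤ := fun a b => max 0 (-((b - a) / n))
  have hW : ∀ a b, a - b ≤ n * W a b := by
    intro a b
    have h1 : (n : ℤ) * ((b - a) / n) ≤ b - a := Int.mul_ediv_self_le (by omega)
    have h2 : (n : ℤ) * -((b - a) / n) ≤ n * W a b :=
      mul_le_mul_of_nonneg_left (le_max_right _ _) (by omega)
    linarith
  have hW' : ∀ a b, W a b = 0 ∨ n * (W a b - 1) < a - b := by
    intro a b
    by_cases h0 : W a b = 0
    · exact Or.inl h0
    · right
      have h1 : W a b = -((b - a) / n) := max_eq_right (by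
        by_contra! h2
        exact h0 (max_eq_left h2.le))
      have h3 := Int.lt_mul_ediv_self_add (x := b - a) (k := (n : ℤ)) (by omega)
      rw [h1]
      linarith
  obtain ⟨u, v, σ, huv, hσ⟩ := exists_potential_perm fun a b => W (x a) (y b)
  obtain ⟨a₀, hx0, hy0⟩ := h σ
  have h0 : u a₀ + v (σ a₀) = 0 := by
    rw [hσ, hx0, hy0]
    refine max_eq_left (neg_nonpos.2 (Int.ediv_nonneg (by omega) (by omega)))
  set c := u a₀
  have hu : ∀ a, 0 ≤ u a - c := fun a => by
    have h1 := huv a (σ a₀)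
    have h2 : 0 ≤ W (x a) (y (σ a₀)) := le_max_left _ _
    linarith
  have hv : ∀ b, 0 ≤ v b + c := fun b => by
    have h1 := huv a₀ b
    have h2 : 0 ≤ W (x a₀) (y b) := le_max_left _ _
    linarith
  obtain ⟨b₀, -, hb₀⟩ := Finset.exists_min_image Finset.univ (fun b => y b + n * (v b + c))
    ⟨a₀, Finset.mem_univ _⟩
  have hp0 : 0 ≤ y b₀ + n * (v b₀ + c) := by
    have h1 := huv a₀ b₀
    have h2 := hW (x a₀) (y b₀)
    have h3 : (n : ℤ) * W (x a₀) (y b₀) ≤ n * (u a₀ + v b₀) :=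
      mul_le_mul_of_nonneg_left h1 (by omega)
    have h4 : (n : ℤ) * (u a₀ + v b₀) = n * (v b₀ + c) := by ring
    linarith
  have hpm : y b₀ + n * (v b₀ + c) ≤ m := by
    have h1 := hb₀ (σ a₀) (Finset.mem_univ _)
    rwa [hy0, show v (σ a₀) + c = 0 by linarith, mul_zero, add_zero] at h1
  refine ⟨σ, fun a => (u a - c).toNat, fun b => (v b + c).toNat,
    (y b₀ + n * (v b₀ + c)).toNat, by omega, fun a => ?_, fun b => ?_, fun a => ?_⟩
  · rw [Int.toNat_of_nonneg hp0, Int.toNat_of_nonneg (hu a)]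
    have h1 : (n : ℤ) * W (x a) (y b₀) ≤ n * (u a + v b₀) :=
      mul_le_mul_of_nonneg_left (huv a b₀) (by omega)
    have h2 := hW (x a) (y b₀)
    linarith
  · rw [Int.toNat_of_nonneg hp0, Int.toNat_of_nonneg (hv b)]
    linarith [hb₀ b (Finset.mem_univ _)]
  · have h1 : u a - c + (v (σ a) + c) = W (x a) (y (σ a)) := by rw [← hσ a]; ring
    rw [Int.toNat_of_nonneg (hu a), Int.toNat_of_nonneg (hv _), h1]
    refine (hW' _ _).imp_left fun h2 => ?_
    have := hu a
    have := hv (σ a)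
    change (u a - c).toNat + (v (σ a) + c).toNat = 0
    omega

namespace NilRep

/-- The extension of `A` by `B` determined by a degree one map. -/
@[reducible] def extRep (A B : NilRep n k) (φ : A.M →ₗ[k] B.M)
    (hφ : ∀ i a, φ (A.pr i a) = B.pr (i + 1) (φ a)) : NilRep n k where
  M := A.M × B.M
  pr i := (A.pr i).prodMap (B.pr i)
  t := (A.t ∘ₗ LinearMap.fst k A.M B.M).prod
    (φ ∘ₗ LinearMap.fst k A.M B.M + B.t ∘ₗ LinearMap.snd k A.M B.M)
  idem i j := by
    refine LinearMap.ext fun v => ?_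
    simp only [LinearMap.comp_apply, LinearMap.prodMap_apply, pr_pr]
    split_ifs <;> rfl
  sum := by
    refine LinearMap.ext fun v => ?_
    rw [LinearMap.sum_apply]
    refine Prod.ext ?_ ?_
    · rw [Prod.fst_sum]
      exact A.sum_pr v.1
    · rw [Prod.snd_sum]
      exact B.sum_pr v.2
  comm i := by
    refine LinearMap.ext fun v => Prod.ext (A.t_pr i v.1) ?_
    change φ (A.pr i v.1) + B.t (B.pr i v.2) = B.pr (i + 1) (φ v.1 + B.t v.2)
    rw [hφ, B.t_pr, map_add]
  nil := by
    obtain ⟨a, ha⟩ := A.nil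
    obtain ⟨b, hb⟩ := B.nil
    refine ⟨b + a, LinearMap.ext fun v => ?_⟩
    set T : A.M × B.M →ₗ[k] A.M × B.M := (A.t ∘ₗ LinearMap.fst k A.M B.M).prod
      (φ ∘ₗ LinearMap.fst k A.M B.M + B.t ∘ₗ LinearMap.snd k A.M B.M) with hT
    have h1 : ∀ c, ((T ^ c) v).1 = (A.t ^ c) v.1 := by
      intro c
      induction c with
      | zero => rfl
      | succ c ih => rw [pow_succ', pow_succ', End.mul_apply, End.mul_apply, ← ih]; rfl
    have h2 : ∀ c y, (T ^ c) (0, y) = (0, (B.t ^ c) y) := by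
      intro c y
      induction c with
      | zero => rfl
      | succ c ih =>
        rw [pow_succ', pow_succ', End.mul_apply, End.mul_apply, ih]
        simp [hT]
    have h3 : (T ^ a) v = (0, ((T ^ a) v).2) := Prod.ext (by rw [h1, ha]; rfl) rfl
    rw [pow_add, End.mul_apply, h3, h2, hb]
    rfl

section extRep

variable {A B : NilRep n k} {φ : A.M →ₗ[k] B.M} {hφ : ∀ i a, φ (A.pr i a) = B.pr (i + 1) (φ a)}

theorem isRepHom_fst : IsRepHom (extRep A B φ hφ) A (LinearMap.fst k A.M B.M) :=
  ⟨fun _ => rfl, rfl⟩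

theorem isRepHom_inr : IsRepHom B (extRep A B φ hφ) (LinearMap.inr k A.M B.M) :=
  ⟨fun i => LinearMap.ext fun b => Prod.ext (map_zero (A.pr i)).symm rfl,
    LinearMap.ext fun b => Prod.ext (map_zero A.t).symm (by simp)⟩

theorem isExtensionOf_extRep : IsExtensionOf (extRep A B φ hφ) A B :=
  ⟨_, _, isRepHom_inr, isRepHom_fst, LinearMap.inr_injective, LinearMap.fst_surjective,
    LinearMap.range_inr k A.M B.M⟩

theorem le_rk_extRep_of_fst {m w : ℕ} {i : ZMod n} {x : A.M} (hx : A.pr i x = x)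
    (h : (A.t ^ (m + n * w)) x ≠ 0) : w + 1 ≤ (extRep A B φ hφ).rk m i := by
  refine le_rk (x := (x, 0)) _ (Prod.ext hx (map_zero (B.pr i))) fun h0 => h ?_
  have := (isRepHom_fst (hφ := hφ)).pow_t_apply (m + n * w) (x, 0)
  rw [h0, map_zero] at this
  exact this.symm

theorem le_rk_extRep_of_snd {m w : ℕ} {i : ZMod n} {y : B.M} (hy : B.pr i y = y)
    (h : (B.t ^ (m + n * w)) y ≠ 0) : w + 1 ≤ (extRep A B φ hφ).rk m i := by
  refine le_rk (x := (0, y)) _ (Prod.ext (map_zero (A.pr i)) hy) fun h0 => h ?_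
  have := (isRepHom_inr (hφ := hφ)).pow_t_apply (m + n * w) y
  exact LinearMap.inr_injective ((this.trans h0).trans (map_zero _).symm)

theorem extRep_pow_t_apply {r : ℕ} {x : A.M} (h : ∀ c < r, φ ((A.t ^ c) x) = 0) :
    ((extRep A B φ hφ).t ^ r) (x, 0) = ((A.t ^ r) x, 0) := by
  induction r with
  | zero => rfl
  | succ r ih =>
    rw [pow_succ', End.mul_apply, ih fun c hc => h c (by omega), pow_succ', End.mul_apply]
    refine Prod.ext rfl ?_
    change φ ((A.t ^ r) x) + B.t 0 = 0
    rw [h r (by omega), map_zero, add_zero]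

theorem le_rk_extRep {m w r q : ℕ} {i : ZMod n} {x : A.M} (hx : A.pr i x = x)
    (h : ∀ c < r, φ ((A.t ^ c) x) = 0) (hr : (A.t ^ (r + 1)) x = 0)
    (hq : (B.t ^ q) (φ ((A.t ^ r) x)) ≠ 0) (hm : m + n * w = q + (r + 1)) :
    w + 1 ≤ (extRep A B φ hφ).rk m i := by
  refine le_rk (x := (x, 0)) _ (Prod.ext hx (map_zero (B.pr i))) fun h0 => hq ?_
  have h1 : ((extRep A B φ hφ).t ^ (r + 1)) (x, 0) = (0, φ ((A.t ^ r) x)) := by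
    rw [pow_succ', End.mul_apply, extRep_pow_t_apply h]
    refine Prod.ext ?_ ?_
    · change A.t ((A.t ^ r) x) = 0
      rw [← hr, pow_succ', End.mul_apply]
    · change φ ((A.t ^ r) x) + B.t 0 = _
      rw [map_zero, add_zero]
  rw [hm, pow_add, End.mul_apply, h1] at h0
  have := (isRepHom_inr (hφ := hφ)).pow_t_apply q (φ ((A.t ^ r) x))
  exact LinearMap.inr_injective ((this.trans h0).trans (map_zero _).symm)

end extRep

/-- Summands outside of the range of an injection can be dropped if they vanish. -/
theorem isoRep_piRep_comp {ι κ : Type} [Fintype ι] [Fintype κ] (Y : ι → NilRep n k) {f : κ → ι}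
    (hf : Function.Injective f) (h : ∀ x, x ∉ Set.range f → Subsingleton (Y x).M) :
    IsoRep (piRep Y) (piRep fun a => Y (f a)) := by
  refine IsoRep.of_bijective (isRepHom_pi fun a => isRepHom_proj Y (f a)) ⟨?_, ?_⟩
  · intro v w hvw
    refine funext fun x => ?_
    by_cases hx : x ∈ Set.range f
    · obtain ⟨a, rfl⟩ := hx
      exact congrFun hvw a
    · have := h x hx
      exact Subsingleton.elim _ _
  · intro w
    have hex : ∀ x, ∃ z : (Y x).M, ∀ a (e : f a = x), e ▸ w a = z := by
      intro x
      by_cases hx : x ∈ Set.range f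
      · obtain ⟨a, rfl⟩ := hx
        refine ⟨w a, fun b e => ?_⟩
        obtain rfl := hf e
        rfl
      · exact ⟨0, fun a e => (hx ⟨a, e⟩).elim⟩
    choose v hv using hex
    exact ⟨v, funext fun a => (hv (f a) a rfl).symm⟩

theorem rk_uni_le {j : ZMod n} {l p : ℕ} {i : ZMod n} {S : Finset ℕ}
    (hS : ∀ s : ℕ, s + p < l → i + p + s = j → s ∈ S) :
    (uni j l : NilRep n k).rk p i ≤ S.card := by
  classical
  let R := range (((uni j l : NilRep n k).t ^ p) ∘ₗ (uni j l : NilRep n k).pr i)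
  let F : (Fin l → k) →ₗ[k] (S → k) :=
    LinearMap.pi fun s => if h : (s : ℕ) < l then LinearMap.proj ⟨s, h⟩ else 0
  have hF : Function.Injective (F.domRestrict R) := by
    refine (injective_iff_map_eq_zero _).2 ?_
    rintro ⟨_, v, rfl⟩ h
    refine Subtype.ext (funext fun s => ?_)
    change (((uni j l : NilRep n k).t ^ p) ((uni j l : NilRep n k).pr i v) : Fin l → k) s = 0
    by_cases hs : (s : ℕ) ∈ S
    · have h1 := congrFun h ⟨s, hs⟩
      simp only [F, LinearMap.domRestrict_apply, LinearMap.pi_apply, dif_pos s.2] at h1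
      exact h1
    · rw [uni_pow_t_apply]
      split_ifs with h1
      · rw [uni_pr_apply, if_neg]
        intro h2
        refine hs (hS s h1 ?_)
        rw [← h2]
        push_cast
        ring
      · rfl
  have := LinearMap.finrank_le_finrank_of_injective hF
  rwa [Module.finrank_fintype_fun_eq_card, Fintype.card_coe] at this

/-- The length of the part of `uni j l` generated in the first possible occurrence of `i`. -/
def srcOff (i : ZMod n) (s : ZMod n × ℕ) : ℤ := s.2 - (i - s.1 + s.2 - 1).val

/-- The deficit of `uni j l` against `m` steps starting at the last occurrence of `i`. -/
def tgtOff (i : ZMod n) (m : ℕ) (s : ZMod n × ℕ) : ℤ := m - s.2 + (s.1 - i - m).val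

theorem rk_uni_le_of_srcOff {i : ZMod n} {s : ZMod n × ℕ} {p u : ℕ}
    (h : srcOff i s - p ≤ n * u) : (uni s.1 s.2 : NilRep n k).rk p i ≤ u := by
  obtain ⟨j, l⟩ := s
  set d := (i - j + l - 1).val with hd
  have hS := rk_uni_le (k := k) (j := j) (l := l) (p := p) (i := i)
    (S := (Finset.range u).image fun q => l - 1 - p - d - n * q) ?_
  · exact hS.trans (Finset.card_image_le.trans_eq (Finset.card_range u))
  · intro s hs hj
    have hmod : (l - 1 - p - s) % n = d := by
      rw [hd, ← ZMod.val_natCast, ← hj, Nat.cast_sub (by omega), Nat.cast_sub (by omega),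
        Nat.cast_sub (by omega)]
      congr 1
      push_cast
      ring
    have hdiv := Nat.div_add_mod (l - 1 - p - s) n
    rw [hmod] at hdiv
    refine Finset.mem_image.2 ⟨(l - 1 - p - s) / n, Finset.mem_range.2 ?_, by omega⟩
    refine Nat.lt_of_mul_lt_mul_left (a := n) ?_
    have h' : (l : ℤ) - d - p ≤ n * u := h
    zify
    zify at hdiv
    omega

theorem rk_uni_le_of_tgtOff {i : ZMod n} {m : ℕ} {s : ZMod n × ℕ} {p v : ℕ} (hp : p ≤ m)
    (h : p - tgtOff i m s ≤ n * v) : (uni s.1 s.2 : NilRep n k).rk (m - p) (i + p) ≤ v := by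
  obtain ⟨j, l⟩ := s
  set e := (j - i - m).val with he
  have hS := rk_uni_le (k := k) (j := j) (l := l) (p := m - p) (i := i + p)
    (S := (Finset.range v).image fun q => e + n * q) ?_
  · exact hS.trans (Finset.card_image_le.trans_eq (Finset.card_range v))
  · intro s hs hj
    have hmod : s % n = e := by
      rw [he, ← ZMod.val_natCast, ← hj, Nat.cast_sub hp]
      congr 1
      ring
    have hdiv := Nat.div_add_mod s n
    rw [hmod] at hdiv
    refine Finset.mem_image.2 ⟨s / n, Finset.mem_range.2 ?_, by omega⟩
    refine Nat.lt_of_mul_lt_mul_left (a := n) ?_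
    have h' : (p : ℤ) - (m - l + e) ≤ n * v := h
    zify
    zify at hdiv
    omega

end NilRep

namespace NilRep

theorem uni_pr_single {i j : ZMod n} {l : ℕ} {r : Fin l} (h : i + (r : ℕ) = j) :
    (uni j l : NilRep n k).pr i (Pi.single r 1) = Pi.single r 1 := by
  refine funext fun c => ?_
  rw [uni_pr_apply]
  split_ifs with h1
  · rfl
  · rw [Pi.single_eq_of_ne]
    rintro rfl
    exact h1 h

theorem uni_pow_t_single_apply (j : ZMod n) {l c : ℕ} {r s : Fin l} :
    (((uni j l : NilRep n k).t ^ c) (Pi.single r 1) : Fin l → k) s =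
      if (s : ℕ) + c = r then 1 else 0 := by
  rw [uni_pow_t_apply]
  split_ifs with h1 h2 h2
  · rw [show (⟨s + c, h1⟩ : Fin l) = r from Fin.ext h2, Pi.single_eq_same]
  · rw [Pi.single_eq_of_ne]
    exact fun h => h2 (congrArg Fin.val h)
  · omega
  · rfl

theorem uni_pow_t_single_ne_zero (j : ZMod n) {l c : ℕ} {r : Fin l} (hc : c ≤ r) :
    ((uni j l : NilRep n k).t ^ c) (Pi.single r 1) ≠ 0 := by
  intro h0
  have h1 := congrFun h0 ⟨r - c, by omega⟩
  rw [uni_pow_t_single_apply, if_pos (by simp only; omega)] at h1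
  exact one_ne_zero h1

theorem exists_isExtensionOf_uni_le_rk (i : ZMod n) (m w : ℕ) (s s' : ZMod n × ℕ)
    (h : w = 0 ∨ n * (w - 1 : ℤ) < srcOff i s - tgtOff i m s') :
    ∃ E : NilRep n k, IsExtensionOf E (uni s.1 s.2) (uni s'.1 s'.2) ∧ w ≤ E.rk m i := by
  classical
  obtain ⟨j, l⟩ := s
  obtain ⟨j', l'⟩ := s'
  have triv : IsExtensionOf (extRep (uni j l : NilRep n k) (uni j' l' : NilRep n k) 0
    fun i a => (map_zero _).symm) (uni j l) (uni j' l') := isExtensionOf_extRep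
  rcases w with _ | w
  · exact ⟨_, triv, Nat.zero_le _⟩
  rcases h with h | h
  · omega
  set d := (i - j + l - 1).val with hd
  set e := (j' - i - m).val with he
  have hdz : (d : ZMod n) = i - j + l - 1 := ZMod.natCast_zmod_val _
  have hez : (e : ZMod n) = j' - i - m := ZMod.natCast_zmod_val _
  replace h : ((n * w : ℕ) : ℤ) < (l - d) - (m - l' + e) := by
    push_cast at h ⊢
    rw [add_sub_cancel_right] at h
    exact h
  have hdeg : ∀ r : ℕ, r + d + 1 = l → i + (r : ZMod n) = j := by
    intro r hr
    have : i + (r : ZMod n) = i + ((r + d + 1 : ℕ) : ZMod n) - d - 1 := by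
      push_cast
      ring
    rw [this, hr, hdz]
    ring
  by_cases h1 : m + n * w + d < l
  · refine ⟨_, triv, le_rk_extRep_of_fst (x := Pi.single ⟨l - 1 - d, by omega⟩ 1)
      (uni_pr_single (hdeg _ (by simp only; omega)))
      (uni_pow_t_single_ne_zero j (by simp only; omega))⟩
  by_cases h2 : l ≤ d
  · refine ⟨_, triv, le_rk_extRep_of_snd (y := Pi.single ⟨m + n * w + e, by omega⟩ 1)
      (uni_pr_single ?_) (uni_pow_t_single_ne_zero j' (by simp only; omega))⟩
    push_cast
    rw [hez, ZMod.natCast_self]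
    ring
  obtain ⟨l, rfl⟩ : ∃ l₀, l = l₀ + 1 := ⟨l - 1, by omega⟩
  obtain ⟨q, hq⟩ : ∃ q, m + n * w = q + (l - d + 1) := ⟨m + n * w - (l - d + 1), by omega⟩
  let y : Fin l' := ⟨q + e, by omega⟩
  have hy : j + 1 + ((y : ℕ) : ZMod n) = j' := by
    have h3 : (q : ZMod n) = ((m + n * w : ℕ) : ZMod n) - (l - d + 1) := by
      rw [hq]
      push_cast [Nat.cast_sub (show d ≤ l by omega)]
      ring
    simp only [y]
    push_cast at h3 hdz ⊢
    rw [h3, hez, hdz, ZMod.natCast_self]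
    ring
  let φ : (Fin (l + 1) → k) →ₗ[k] (Fin l' → k) := (LinearMap.proj 0).smulRight (Pi.single y 1)
  have hφ : ∀ i a, φ ((uni j (l + 1) : NilRep n k).pr i a) =
      (uni j' l' : NilRep n k).pr (i + 1) (φ a) := by
    intro i' a
    refine funext fun c => ?_
    rw [uni_pr_apply]
    simp only [φ, LinearMap.smulRight_apply, LinearMap.proj_apply, Pi.smul_apply, smul_eq_mul]
    rw [uni_pr_apply]
    by_cases hc : c = y
    · subst hc
      have hiff : i' + 1 + ((y : ℕ) : ZMod n) = j' ↔ i' = j := by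
        rw [← hy, add_left_inj, add_left_inj]
      simp [hiff]
    · simp [Pi.single_eq_of_ne hc]
  have hr : l - d < l + 1 := by omega
  refine ⟨_, isExtensionOf_extRep (hφ := hφ), le_rk_extRep (r := l - d) (q := q)
    (x := Pi.single ⟨l - d, hr⟩ 1) (uni_pr_single (hdeg _ (by simp only; omega))) ?_ ?_ ?_ hq⟩
  · intro c hc
    simp only [φ, LinearMap.smulRight_apply, LinearMap.proj_apply]
    rw [uni_pow_t_single_apply, if_neg (by simp; omega), zero_smul]
  · refine funext fun c => ?_
    rw [uni_pow_t_single_apply, if_neg (by simp only; omega)]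
    rfl
  · simp only [φ, LinearMap.smulRight_apply, LinearMap.proj_apply]
    rw [uni_pow_t_single_apply, if_pos (by simp), one_smul]
    exact uni_pow_t_single_ne_zero j' (by simp only [y]; omega)

/-- The bound `IsExtensionOf.rk_le` is attained by a suitable extension. -/
theorem exists_isExtensionOf_rk_add_rk_le (A B : NilRep n k) (m : ℕ) (i : ZMod n) :
    ∃ (C : NilRep n k) (p : ℕ), IsExtensionOf C A B ∧ p ≤ m ∧
      A.rk p i + B.rk (m - p) (i + p) ≤ C.rk m i := by
  obtain ⟨J, _, s, hs⟩ := A.exists_iso_piRep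
  obtain ⟨K, _, s', hs'⟩ := B.exists_iso_piRep
  let x : J ⊕ Option K → ZMod n × ℕ := Sum.elim s fun _ => (i - 1, 0)
  let y : J ⊕ Option K → ZMod n × ℕ :=
    Sum.elim (fun _ => (i + m, 0)) fun o => o.elim (i + m, 0) s'
  have hx : ∀ o, srcOff i (x (Sum.inr o)) = 0 := fun o => by simp [x, srcOff]
  have hy : ∀ b, (¬ ∃ c, b = Sum.inr (some c)) → tgtOff i m (y b) = m := by
    rintro (b | _ | c) h
    · simp [y, tgtOff]
    · simp [y, tgtOff]
    · exact absurd ⟨c, rfl⟩ h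
  obtain ⟨σ, u, v, p, hp, hu, hv, huv⟩ := exists_potential_shift (Nat.pos_of_neZero n)
    (fun a => srcOff i (x a)) (fun b => tgtOff i m (y b)) (m := m) (by
      intro σ
      by_contra! h
      have h' : ∀ o : Option K, ∃ c : K, σ (Sum.inr o) = Sum.inr (some c) := fun o => by
        by_contra h''
        exact h _ (hx o) (hy _ h'')
      choose f hf using h'
      have hinj : Function.Injective f := fun o o' h => by
        have := (hf o).trans ((congrArg (fun c => Sum.inr (some c)) h).trans (hf o').symm)
        exact Sum.inr_injective (σ.injective this)
      have := Fintype.card_le_of_injective f hinj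
      rw [Fintype.card_option] at this
      omega)
  have hA : IsoRep (piRep fun a => (uni (x a).1 (x a).2 : NilRep n k)) A := by
    refine (isoRep_piRep_comp (κ := J) _ Sum.inl_injective ?_).trans hs.symm
    rintro (a | o) h
    · exact absurd ⟨a, rfl⟩ h
    · exact inferInstanceAs (Subsingleton (Fin 0 → k))
  have hB : IsoRep (piRep fun b => (uni (y b).1 (y b).2 : NilRep n k)) B := by
    refine (isoRep_piRep_comp (κ := K) _ (f := fun c => Sum.inr (some c))
      (Sum.inr_injective.comp (Option.some_injective K)) ?_).trans hs'.symm
    rintro (a | _ | c) h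
    · exact inferInstanceAs (Subsingleton (Fin 0 → k))
    · exact inferInstanceAs (Subsingleton (Fin 0 → k))
    · exact absurd ⟨c, rfl⟩ h
  choose E hE hrk using fun a => exists_isExtensionOf_uni_le_rk (k := k) i m (u a + v (σ a))
    (x a) (y (σ a)) (by simpa using huv a)
  have hBσ := (isoRep_piRep_comp (fun b => (uni (y b).1 (y b).2 : NilRep n k)) σ.injective
    fun b h => absurd (σ.surjective b) h).symm.trans hB
  refine ⟨piRep E, p, (isExtensionOf_piRep hE).of_iso hA hBσ, hp, ?_⟩
  rw [← hA.rk_eq, ← hB.rk_eq, rk_piRep, rk_piRep, rk_piRep]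
  calc _ ≤ ∑ a, u a + ∑ b, v b := add_le_add
        (Finset.sum_le_sum fun a _ => rk_uni_le_of_srcOff (hu a))
        (Finset.sum_le_sum fun b _ => rk_uni_le_of_tgtOff hp (hv b))
    _ = ∑ a, (u a + v (σ a)) := by rw [Finset.sum_add_distrib, Equiv.sum_comp σ v]
    _ ≤ _ := Finset.sum_le_sum fun a _ => hrk a

end NilRep

/-- Degeneration is compatible with generic extensions: if `M' ≤_deg M` and `N' ≤_deg N`,
then `M' * N' ≤_deg M * N` for the generic extensions. -/
theorem stmt4 (n : ℕ) [NeZero n] (k : Type) [Field k]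
    (M M' N N' G G' : NilRep n k)
    (hM : DegLe M' M) (hN : DegLe N' N)
    (hG : IsGenericExt M N G) (hG' : IsGenericExt M' N' G') :
    DegLe G' G := by
  refine degLe_of_rk_le (fun i => ?_) fun m i => ?_
  · rw [hG.1.dimAt_eq, hG'.1.dimAt_eq, hM.1, hN.1]
  · obtain ⟨C, p, hC, hp, hle⟩ := M.exists_isExtensionOf_rk_add_rk_le N m i
    calc G'.rk m i = G'.rk (p + (m - p)) i := by rw [Nat.add_sub_cancel' hp]
      _ ≤ M'.rk p i + N'.rk (m - p) (i + p) := hG'.1.rk_le _ _ _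
      _ ≤ M.rk p i + N.rk (m - p) (i + p) := add_le_add (hM.rk_le _ _) (hN.rk_le _ _)
      _ ≤ C.rk m i := hle
      _ ≤ G.rk m i := (hG.2 C hC).rk_le _ _
end

section
/- The generic extension operation on isomorphism classes of nilpotent representations of a cyclic quiver is associative: L * (M * N) ≅ (L * M) * N for all nilpotent representations L, M, N. Consequently the set of isomorphism classes with [M]*[N] = [M*N] and identity [0] is a monoid. -/
variable {n : ℕ} [NeZero n] {k : Type} [Field k]

section LinearAlgebra

open Module Submodule

variable {V W X Y Z T Q : Type*} [AddCommGroup V] [Module k V] [AddCommGroup W] [Module k W]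
  [AddCommGroup X] [Module k X] [AddCommGroup Y] [Module k Y] [AddCommGroup Z] [Module k Z]
  [AddCommGroup T] [Module k T] [AddCommGroup Q] [Module k Q]

theorem finrank_sup_of_disjoint [FiniteDimensional k V] {S U : Submodule k V}
    (h : Disjoint S U) : finrank k ↥(S ⊔ U) = finrank k S + finrank k U := by
  rw [← finrank_sup_add_finrank_inf_eq, h.eq_bot, finrank_bot, add_zero]

theorem finrank_map_add_finrank_inf_ker [FiniteDimensional k V] (f : V →ₗ[k] W)
    (S : Submodule k V) :
    finrank k ↥(S.map f) + finrank k ↥(S ⊓ LinearMap.ker f) = finrank k S := by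
  have h := (f.domRestrict S).finrank_range_add_finrank_ker
  rw [LinearMap.range_domRestrict, LinearMap.ker_domRestrict] at h
  rw [← h, ← map_comap_subtype, finrank_map_subtype_eq]

theorem exists_finrank_eq_comparable_chain [FiniteDimensional k V] {F : ℕ → Submodule k V}
    (hF : Monotone F) (d : ℕ) (hd : d ≤ finrank k V) :
    ∃ G : Submodule k V, finrank k G = d ∧ ∀ l, F l ≤ G ∨ G ≤ F l := by
  classical
  induction d with
  | zero => exact ⟨⊥, finrank_bot k V, fun l => Or.inr bot_le⟩
  | succ d ih =>
    obtain ⟨G, hG, hFG⟩ := ih (by lia)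
    by_cases h : ∃ l, ¬ F l ≤ G
    · obtain ⟨x, hxF, hxG⟩ := SetLike.not_le_iff_exists.1 (Nat.find_spec h)
      refine ⟨G ⊔ span k {x}, by rw [finrank_sup_span_singleton hxG, hG], fun l => ?_⟩
      by_cases hl : l < Nat.find h
      · exact Or.inl ((not_not.1 (Nat.find_min h hl)).trans le_sup_left)
      · have hle := hF (not_lt.1 hl)
        refine Or.inr (sup_le (((hFG _).resolve_left (Nat.find_spec h)).trans hle) ?_)
        rw [span_singleton_le_iff_mem]
        exact hle hxF
    · push Not at h
      have hne : G ≠ ⊤ := by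
        rintro rfl
        rw [finrank_top] at hG
        lia
      obtain ⟨x, -, hx⟩ := SetLike.exists_of_lt hne.lt_top
      exact ⟨G ⊔ span k {x}, by rw [finrank_sup_span_singleton hx, hG],
        fun l => Or.inl ((h l).trans le_sup_left)⟩

theorem exists_disjoint_disjoint_finrank_eq [FiniteDimensional k V] {G B : Submodule k V}
    (h : finrank k G = finrank k B) (d : ℕ) (hd : d + finrank k G ≤ finrank k V) :
    ∃ P : Submodule k V, finrank k P = d ∧ Disjoint P G ∧ Disjoint P B := by
  induction d with
  | zero => exact ⟨⊥, finrank_bot k V, disjoint_bot_left, disjoint_bot_left⟩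
  | succ d ih =>
    obtain ⟨P, hP, hPG, hPB⟩ := ih (by lia)
    have h1 : ¬ (⊤ : Submodule k V) ≤ P ⊔ G := fun hle => by
      have := finrank_sup_of_disjoint hPG
      rw [top_le_iff.1 hle, finrank_top] at this
      lia
    have h2 : ¬ (⊤ : Submodule k V) ≤ P ⊔ B := fun hle => by
      have := finrank_sup_of_disjoint hPB
      rw [top_le_iff.1 hle, finrank_top] at this
      lia
    have h3 : ¬ ((⊤ : Submodule k V) : Set V) ⊆ ↑(P ⊔ G) ∪ ↑(P ⊔ B) := fun hle =>
      (AddSubgroupClass.subset_union.1 hle).elim h1 h2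
    obtain ⟨x, -, hx⟩ := Set.not_subset.1 h3
    have hxG : x ∉ P ⊔ G := fun h => hx (Or.inl h)
    have hxB : x ∉ P ⊔ B := fun h => hx (Or.inr h)
    refine ⟨P ⊔ span k {x}, ?_, ?_, ?_⟩
    · rw [finrank_sup_span_singleton fun h => hxG (mem_sup_left h), hP]
    · rw [sup_comm]
      exact hPG.disjoint_sup_left_of_disjoint_sup_right (disjoint_span_singleton_of_notMem hxG).symm
    · rw [sup_comm]
      exact hPB.disjoint_sup_left_of_disjoint_sup_right (disjoint_span_singleton_of_notMem hxB).symm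

/-- A surjection lifts along a surjection to a surjection when dimensions allow it. -/
theorem exists_surjective_lift [FiniteDimensional k V] [FiniteDimensional k T]
    {α : T →ₗ[k] Q} {β : V →ₗ[k] Q} (hα : Function.Surjective α) (hβ : Function.Surjective β)
    (h : finrank k V ≤ finrank k T) :
    ∃ φ : T →ₗ[k] V, Function.Surjective φ ∧ β ∘ₗ φ = α := by
  obtain ⟨s, hs⟩ := α.exists_rightInverse_of_surjective (LinearMap.range_eq_top.2 hα)
  obtain ⟨σ, hσ⟩ := β.exists_rightInverse_of_surjective (LinearMap.range_eq_top.2 hβ)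
  have hs' : ∀ q, α (s q) = q := LinearMap.congr_fun hs
  have hσ' : ∀ q, β (σ q) = q := LinearMap.congr_fun hσ
  have hα' := α.finrank_range_add_finrank_ker
  have hβ' := β.finrank_range_add_finrank_ker
  rw [LinearMap.range_eq_top.2 hα] at hα'
  rw [LinearMap.range_eq_top.2 hβ] at hβ'
  obtain ⟨g, hg⟩ : ∃ g : LinearMap.ker α →ₗ[k] LinearMap.ker β, Function.Surjective g := by
    obtain ⟨i, hi⟩ := finrank_le_iff_exists_linearMap.1
      (show finrank k (LinearMap.ker β) ≤ finrank k (LinearMap.ker α) by lia)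
    obtain ⟨g, hg⟩ := i.exists_leftInverse_of_injective (LinearMap.ker_eq_bot.2 hi)
    exact ⟨g, fun x => ⟨i x, LinearMap.congr_fun hg x⟩⟩
  let r : T →ₗ[k] LinearMap.ker α :=
    (LinearMap.id - s ∘ₗ α).codRestrict _ fun x => by simp [hs']
  have hr : ∀ z : LinearMap.ker α, r z = z := fun z => by
    ext
    simp [r]
  have hrs : ∀ q, r (s q) = 0 := fun q => by
    ext
    simp [r, hs']
  refine ⟨σ ∘ₗ α + (LinearMap.ker β).subtype ∘ₗ g ∘ₗ r, fun p => ?_, ?_⟩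
  · obtain ⟨z, hz⟩ := hg ⟨p - σ (β p), by simp [hσ']⟩
    refine ⟨z + s (β p), ?_⟩
    simp [hs', hr, hrs, hz]
  · ext x
    simp [hσ']

theorem exists_lift_of_range_le {h : T →ₗ[k] Q} {π : V →ₗ[k] Q} {R : Submodule k V}
    (hR : LinearMap.range h ≤ R.map π) :
    ∃ ρ : T →ₗ[k] V, LinearMap.range ρ ≤ R ∧ π ∘ₗ ρ = h := by
  have hsurj : LinearMap.range ((π.domRestrict R).codRestrict (R.map π)
      fun x => mem_map_of_mem x.2) = ⊤ := by
    rw [LinearMap.range_eq_top]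
    rintro ⟨_, y, hy, rfl⟩
    exact ⟨⟨y, hy⟩, rfl⟩
  obtain ⟨g, hg⟩ := LinearMap.exists_rightInverse_of_surjective _ hsurj
  refine ⟨R.subtype ∘ₗ g ∘ₗ h.codRestrict (R.map π) fun x => hR ⟨x, rfl⟩, ?_, ?_⟩
  · rw [LinearMap.range_le_iff_comap, eq_top_iff]
    intro x _
    simp
  · ext x
    exact congrArg Subtype.val (LinearMap.congr_fun hg ⟨h x, hR ⟨x, rfl⟩⟩)

/-- A lift of a surjection along a surjection can be chosen in general position with respect to
a chain of subspaces. -/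
theorem exists_generic_lift_of_surjective [FiniteDimensional k V] [FiniteDimensional k T]
    {α : T →ₗ[k] Q} {π : V →ₗ[k] Q} (hα : Function.Surjective α) (hπ : Function.Surjective π)
    {F : ℕ → Submodule k V} (hF : Monotone F) :
    ∃ φ : T →ₗ[k] V, π ∘ₗ φ = α ∧ ∀ l, LinearMap.range φ ⊔ F l = ⊤ ∨
      finrank k ↥(LinearMap.range φ ⊔ F l) = finrank k T + finrank k (F l) := by
  rcases le_total (finrank k V) (finrank k T) with h | h
  · obtain ⟨φ, hφ, hφα⟩ := exists_surjective_lift hα hπ h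
    exact ⟨φ, hφα, fun l => Or.inl (by rw [LinearMap.range_eq_top.2 hφ, top_sup_eq])⟩
  · obtain ⟨G, hG, hFG⟩ := exists_finrank_eq_comparable_chain hF (finrank k V - finrank k T)
      (Nat.sub_le _ _)
    have hα' := α.finrank_range_add_finrank_ker
    have hπ' := π.finrank_range_add_finrank_ker
    rw [LinearMap.range_eq_top.2 hα] at hα'
    rw [LinearMap.range_eq_top.2 hπ] at hπ'
    obtain ⟨B, hB, hBπ⟩ := exists_finrank_eq_comparable_chain
      (F := fun _ => LinearMap.ker π) monotone_const (finrank k V - finrank k T) (Nat.sub_le _ _)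
    have hBπ : B ≤ LinearMap.ker π := (hBπ 0).elim
      (fun hle => (eq_of_le_of_finrank_le hle (by lia)).ge) id
    obtain ⟨P, hP, hPG, hPB⟩ := exists_disjoint_disjoint_finrank_eq (hG.trans hB.symm)
      (finrank k T) (by lia)
    have hPG' : P ⊔ G = ⊤ := eq_top_of_finrank_eq (by rw [finrank_sup_of_disjoint hPG]; lia)
    have hPB' : P ⊔ B = ⊤ := eq_top_of_finrank_eq (by rw [finrank_sup_of_disjoint hPB]; lia)
    have hβ : Function.Surjective (π.domRestrict P) := by
      intro q
      obtain ⟨v, rfl⟩ := hπ q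
      obtain ⟨p, hp, b, hb, rfl⟩ := mem_sup.1 (hPB'.ge (mem_top (x := v)))
      refine ⟨⟨p, hp⟩, ?_⟩
      simp [LinearMap.mem_ker.1 (hBπ hb)]
    obtain ⟨φ, hφ, hφα⟩ := exists_surjective_lift hα hβ hP.le
    have hrange : LinearMap.range (P.subtype ∘ₗ φ) = P := by
      rw [LinearMap.range_comp, LinearMap.range_eq_top.2 hφ, Submodule.map_top, range_subtype]
    refine ⟨P.subtype ∘ₗ φ, by rw [← hφα]; rfl, fun l => ?_⟩
    rw [hrange]
    rcases hFG l with hl | hl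
    · right
      rw [finrank_sup_of_disjoint (hPG.mono_right hl), hP]
    · left
      exact top_le_iff.1 (hPG'.ge.trans (sup_le_sup_left hl P))

theorem exists_generic_lift [FiniteDimensional k V] [FiniteDimensional k T]
    {α : T →ₗ[k] Q} {π : V →ₗ[k] Q} {R : Submodule k V} (hπ : Function.Surjective π)
    (hα : LinearMap.range α ⊔ R.map π = ⊤)
    {F : ℕ → Submodule k V} (hF : Monotone F) (hRF : ∀ l, R ≤ F l) :
    ∃ φ : T →ₗ[k] V, π ∘ₗ φ = α ∧ ∀ l, LinearMap.range φ ⊔ F l = ⊤ ∨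
      finrank k ↥(LinearMap.range φ ⊔ F l) = finrank k T + finrank k (F l) := by
  let πq : V ⧸ R →ₗ[k] Q ⧸ R.map π := R.mapQ (R.map π) π (le_comap_map π R)
  have hπq : Function.Surjective πq := by
    intro y
    obtain ⟨q, rfl⟩ := (R.map π).mkQ_surjective y
    obtain ⟨v, rfl⟩ := hπ q
    exact ⟨R.mkQ v, rfl⟩
  have hαq : Function.Surjective ((R.map π).mkQ ∘ₗ α) := by
    intro y
    obtain ⟨q, rfl⟩ := (R.map π).mkQ_surjective y
    obtain ⟨_, ⟨t, rfl⟩, b, hb, rfl⟩ := mem_sup.1 (hα.ge (mem_top (x := q)))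
    refine ⟨t, ?_⟩
    simpa using hb
  obtain ⟨φ₀, hφ₀, hφ₀F⟩ := exists_generic_lift_of_surjective hαq hπq
    (F := fun l => (F l).map R.mkQ) (fun i j hij => map_mono (hF hij))
  obtain ⟨s, hs⟩ := R.mkQ.exists_rightInverse_of_surjective R.range_mkQ
  have hs' : ∀ q, R.mkQ (s q) = q := LinearMap.congr_fun hs
  obtain ⟨ρ, hρR, hρ⟩ : ∃ ρ : T →ₗ[k] V, LinearMap.range ρ ≤ R ∧
      π ∘ₗ ρ = α - π ∘ₗ s ∘ₗ φ₀ := by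
    refine exists_lift_of_range_le ?_
    rintro _ ⟨x, rfl⟩
    have h1 : πq (R.mkQ (s (φ₀ x))) = (R.map π).mkQ (α x) := by
      rw [hs']
      exact LinearMap.congr_fun hφ₀ x
    rw [← (R.map π).ker_mkQ, LinearMap.mem_ker, LinearMap.sub_apply, map_sub, ← h1, sub_eq_zero]
    rfl
  have hmk : R.mkQ ∘ₗ (s ∘ₗ φ₀ + ρ) = φ₀ := by
    ext x
    have : R.mkQ (ρ x) = 0 := by simpa using hρR ⟨x, rfl⟩
    rw [LinearMap.comp_apply, LinearMap.add_apply, map_add, this, LinearMap.comp_apply, hs',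
      add_zero]
  have hdim : ∀ S : Submodule k V, R ≤ S →
      finrank k ↥(S.map R.mkQ) + finrank k R = finrank k S := fun S hS => by
    rw [← finrank_map_add_finrank_inf_ker R.mkQ S, ker_mkQ, inf_eq_right.2 hS]
  refine ⟨s ∘ₗ φ₀ + ρ, by rw [LinearMap.comp_add, hρ]; abel, fun l => ?_⟩
  have hRS := (hRF l).trans (le_sup_right (a := LinearMap.range (s ∘ₗ φ₀ + ρ)))
  have hmap : (LinearMap.range (s ∘ₗ φ₀ + ρ) ⊔ F l).map R.mkQ =
      LinearMap.range φ₀ ⊔ (F l).map R.mkQ := by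
    rw [Submodule.map_sup, ← LinearMap.range_comp, hmk]
  have h1 := hdim _ hRS
  have h2 := hdim _ (hRF l)
  rw [hmap] at h1
  rcases hφ₀F l with hl | hl
  · left
    refine eq_top_of_finrank_eq ?_
    rw [← h1, hl, finrank_top, R.finrank_quotient_add_finrank]
  · right
    lia

/-- Extend a linear map from `S` to `W` as a lift of `α` along `π` with values in `E`,
in general position with respect to a chain of subspaces of `E`. -/
theorem exists_generic_extension [FiniteDimensional k X] [FiniteDimensional k Y]
    {S W : Submodule k X} {R E : Submodule k Y} {ψ : X →ₗ[k] Y} {α : X →ₗ[k] Z} {π : Y →ₗ[k] Z}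
    (hSW : S ≤ W) (hRE : R ≤ E) (hψ : S.map ψ ≤ R) (hπψ : ∀ x ∈ S, π (ψ x) = α x)
    (hα : W.map α ⊔ R.map π = E.map π) {F : ℕ → Submodule k Y} (hF : Monotone F)
    (hRF : ∀ l, R ≤ F l) (hFE : ∀ l, F l ≤ E) :
    ∃ φ : X →ₗ[k] Y, (∀ x ∈ S, φ x = ψ x) ∧ W.map φ ≤ E ∧ (∀ x ∈ W, π (φ x) = α x) ∧
      ∀ l, W.map φ ⊔ F l = E ∨
        finrank k ↥(W.map φ ⊔ F l) + finrank k S = finrank k W + finrank k (F l) := by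
  obtain ⟨T₀, hT₀⟩ := S.exists_isCompl
  set T : Submodule k X := W ⊓ T₀ with hT
  have hST : S ⊔ T = W := by
    rw [hT, inf_comm, ← sup_inf_assoc_of_le T₀ hSW, hT₀.sup_eq_top, top_inf_eq]
  have hdisj : Disjoint S T := hT₀.disjoint.mono_right inf_le_right
  have hdim := finrank_sup_of_disjoint hdisj
  rw [hST] at hdim
  have hSR : S.map α ≤ R.map π := by
    rintro _ ⟨x, hx, rfl⟩
    exact ⟨ψ x, hψ (mem_map_of_mem hx), hπψ x hx⟩
  have hαE : ∀ x ∈ W, α x ∈ E.map π := fun x hx =>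
    hα.le (mem_sup_left (mem_map_of_mem hx))
  let α' : T →ₗ[k] E.map π := (α.domRestrict T).codRestrict _ fun x => hαE x x.2.1
  let π' : E →ₗ[k] E.map π := (π.domRestrict E).codRestrict _ fun x => mem_map_of_mem x.2
  have hπ' : Function.Surjective π' := by
    rintro ⟨_, y, hy, rfl⟩
    exact ⟨⟨y, hy⟩, rfl⟩
  have hα' : LinearMap.range α' ⊔ (R.comap E.subtype).map π' = ⊤ := by
    rw [eq_top_iff]
    rintro ⟨z, hz⟩ -
    rw [← hα, ← hST, Submodule.map_sup, sup_right_comm, sup_eq_right.2 hSR, sup_comm] at hz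
    obtain ⟨_, ⟨x, hx, rfl⟩, _, ⟨y, hy, rfl⟩, hxy⟩ := mem_sup.1 hz
    exact mem_sup.2 ⟨α' ⟨x, hx⟩, ⟨_, rfl⟩, π' ⟨y, hRE hy⟩,
      mem_map_of_mem (show (⟨y, hRE hy⟩ : E) ∈ R.comap E.subtype from hy), Subtype.ext hxy⟩
  obtain ⟨φ, hφα, hφF⟩ := exists_generic_lift hπ' hα' (F := fun l => (F l).comap E.subtype)
    (fun i j hij => comap_mono (hF hij)) (fun l => comap_mono (hRF l))
  obtain ⟨e, he⟩ := (E.subtype ∘ₗ φ).exists_extend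
  have he' : ∀ x (hx : x ∈ T), e x = φ ⟨x, hx⟩ := fun x hx => LinearMap.congr_fun he ⟨x, hx⟩
  let q := T₀.projection S hT₀.symm
  have hqS : ∀ x ∈ S, q x = 0 := fun x hx => T₀.projection_apply_of_mem_right hT₀.symm hx
  have hqT : ∀ x ∈ T, q x = x := fun x hx => T₀.projection_apply_of_mem_left hT₀.symm hx.2
  let φ' : X →ₗ[k] Y := e ∘ₗ q + ψ ∘ₗ (LinearMap.id - q)
  have hφS : ∀ x ∈ S, φ' x = ψ x := fun x hx => by simp [φ', hqS x hx]
  have hφT : ∀ x (hx : x ∈ T), φ' x = φ ⟨x, hx⟩ := fun x hx => by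
    simp [φ', hqT x hx, he' x hx]
  have hmapS : S.map φ' ≤ R := by
    rintro _ ⟨x, hx, rfl⟩
    rw [hφS x hx]
    exact hψ (mem_map_of_mem hx)
  have hmapT : T.map φ' = (LinearMap.range φ).map E.subtype := by
    ext y
    constructor
    · rintro ⟨x, hx, rfl⟩
      exact ⟨φ ⟨x, hx⟩, ⟨_, rfl⟩, (hφT x hx).symm⟩
    · rintro ⟨_, ⟨⟨x, hx⟩, rfl⟩, rfl⟩
      exact ⟨x, hx, hφT x hx⟩
  have hmapW : ∀ l, W.map φ' ⊔ F l = (LinearMap.range φ ⊔ (F l).comap E.subtype).map E.subtype := by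
    intro l
    rw [← hST, Submodule.map_sup, sup_right_comm, sup_eq_right.2 (hmapS.trans (hRF l)),
      sup_comm, Submodule.map_sup, hmapT, map_comap_subtype, inf_eq_right.2 (hFE l)]
  refine ⟨φ', hφS, ?_, fun x hx => ?_, fun l => ?_⟩
  · refine le_sup_left.trans ((hmapW 0).le.trans (map_subtype_le _ _))
  · rw [← hST] at hx
    obtain ⟨s, hs, t, ht, rfl⟩ := mem_sup.1 hx
    rw [map_add, map_add, map_add, hφS s hs, hφT t ht, hπψ s hs]
    exact congrArg (α s + ·) (congrArg Subtype.val (LinearMap.congr_fun hφα ⟨t, ht⟩))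
  · rw [hmapW, finrank_map_subtype_eq]
    rcases hφF l with hl | hl
    · left
      rw [hl, map_subtype_top]
    · right
      rw [hl, ← finrank_map_subtype_eq E, map_comap_subtype, inf_eq_right.2 (hFE l), hdim]
      lia

end LinearAlgebra

namespace NilRep

open Module Submodule

theorem pr_pr_apply (A : NilRep n k) (i j : ZMod n) (x : A.M) :
    A.pr i (A.pr j x) = if i = j then A.pr i x else 0 := by
  have h := LinearMap.congr_fun (A.idem i j) x
  split_ifs at h ⊢ <;> exact h

theorem sum_pr_apply (A : NilRep n k) (x : A.M) : ∑ i, A.pr i x = x := by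
  simpa using LinearMap.congr_fun A.sum x

theorem t_pr_apply (A : NilRep n k) (i : ZMod n) (x : A.M) :
    A.t (A.pr i x) = A.pr (i + 1) (A.t x) :=
  LinearMap.congr_fun (A.comm i) x

theorem pow_t_comp_pr (A : NilRep n k) (c : ℕ) (i : ZMod n) :
    (A.t ^ c) ∘ₗ A.pr i = A.pr (i + c) ∘ₗ (A.t ^ c) := by
  induction c with
  | zero => ext; simp
  | succ c ih =>
    ext x
    have h := LinearMap.congr_fun ih x
    simp only [LinearMap.comp_apply] at h ⊢
    rw [pow_succ', Module.End.mul_apply, h, t_pr_apply, Module.End.mul_apply, Nat.cast_succ,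
      add_assoc]

/-- The degree-`i` piece of the image of `t ^ m`. -/
def level (A : NilRep n k) (m : ℕ) (i : ZMod n) : Submodule k A.M :=
  LinearMap.range (A.pr i ∘ₗ A.t ^ m)

theorem level_zero (A : NilRep n k) (i : ZMod n) : A.level 0 i = LinearMap.range (A.pr i) := by
  rw [level, pow_zero]
  rfl

theorem map_pow_level (A : NilRep n k) (m c : ℕ) (i : ZMod n) :
    (A.level m i).map (A.t ^ c) = A.level (m + c) (i + c) := by
  rw [level, level, ← LinearMap.range_comp, ← LinearMap.comp_assoc, pow_t_comp_pr,
    LinearMap.comp_assoc, add_comm m c, pow_add]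
  rfl

theorem map_t_level (A : NilRep n k) (m : ℕ) (i : ZMod n) :
    (A.level m i).map A.t = A.level (m + 1) (i + 1) := by
  simpa using A.map_pow_level m 1 i

theorem level_succ_le (A : NilRep n k) (m : ℕ) (i : ZMod n) :
    A.level (m + 1) i ≤ A.level m i := by
  rintro _ ⟨x, rfl⟩
  exact ⟨A.t x, by simp [pow_succ]⟩

theorem pr_apply_of_mem_level (A : NilRep n k) {m : ℕ} {i : ZMod n} {x : A.M}
    (hx : x ∈ A.level m i) (j : ZMod n) : A.pr j x = if j = i then x else 0 := by
  obtain ⟨y, rfl⟩ := hx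
  rw [LinearMap.comp_apply, pr_pr_apply]
  split_ifs with h
  · rw [h]
  · rfl

theorem pr_mem_level_zero (A : NilRep n k) (i : ZMod n) (x : A.M) : A.pr i x ∈ A.level 0 i := by
  rw [level_zero]
  exact ⟨x, rfl⟩

theorem level_eq_bot (A : NilRep n k) {m : ℕ} (h : A.t ^ m = 0) (i : ZMod n) :
    A.level m i = ⊥ := by
  rw [level, h, LinearMap.comp_zero, LinearMap.range_zero]

end NilRep

open Module Submodule

theorem IsRepHom.apply_pow_t {A B : NilRep n k} {f : A.M →ₗ[k] B.M} (hf : IsRepHom A B f) (m : ℕ)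
    (x : A.M) : f ((A.t ^ m) x) = (B.t ^ m) (f x) := by
  induction m with
  | zero => rfl
  | succ m ih =>
    rw [pow_succ', pow_succ', Module.End.mul_apply, Module.End.mul_apply, ← ih]
    exact LinearMap.congr_fun hf.2 _

theorem IsRepHom.map_level_le {A B : NilRep n k} {f : A.M →ₗ[k] B.M} (hf : IsRepHom A B f) (m : ℕ)
    (i : ZMod n) : (A.level m i).map f ≤ B.level m i := by
  rintro _ ⟨_, ⟨x, rfl⟩, rfl⟩
  exact ⟨f x, by rw [LinearMap.comp_apply, ← hf.apply_pow_t]; exact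
    (LinearMap.congr_fun (hf.1 i) _).symm⟩

/-- Subadditivity of ranks in an extension. -/
theorem IsExtensionOf.finrank_level_le {C A B : NilRep n k} (h : IsExtensionOf C A B) (b c : ℕ)
    (i : ZMod n) : finrank k (C.level (b + c) (i + c)) ≤
      finrank k (A.level b i) + finrank k (B.level c (i + c)) := by
  obtain ⟨f, g, hf, hg, hfi, -, hfg⟩ := h
  have h1 : finrank k (C.level b i) =
      finrank k ↥((C.level b i).map g) + finrank k ↥(C.level b i ⊓ LinearMap.ker g) :=
    (finrank_map_add_finrank_inf_ker g _).symm
  have h2 := finrank_map_add_finrank_inf_ker (C.t ^ c) (C.level b i)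
  have h3 := finrank_map_add_finrank_inf_ker (C.t ^ c) (C.level b i ⊓ LinearMap.ker g)
  have h4 : finrank k ↥(C.level b i ⊓ LinearMap.ker g ⊓ LinearMap.ker (C.t ^ c)) ≤
      finrank k ↥(C.level b i ⊓ LinearMap.ker (C.t ^ c)) :=
    finrank_mono (inf_le_inf_right _ inf_le_left)
  have h5 : (C.level b i ⊓ LinearMap.ker g).map (C.t ^ c) ≤ (B.level c (i + c)).map f := by
    rintro _ ⟨x, ⟨hx, hxg⟩, rfl⟩
    rw [SetLike.mem_coe, ← hfg] at hxg
    obtain ⟨y, rfl⟩ := hxg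
    have hy : y ∈ B.level 0 i := by
      have : f (B.pr i y) = f y := by
        rw [← LinearMap.comp_apply, hf.1 i, LinearMap.comp_apply, C.pr_apply_of_mem_level hx,
          if_pos rfl]
      rw [← hfi this]
      exact B.pr_mem_level_zero i y
    rw [← hf.apply_pow_t]
    refine mem_map_of_mem ?_
    have := mem_map_of_mem (f := B.t ^ c) hy
    rwa [B.map_pow_level, zero_add] at this
  have h6 := (finrank_mono h5).trans (finrank_map_le f _)
  have h7 := finrank_mono (hg.map_level_le b i)
  rw [C.map_pow_level] at h2
  lia

theorem finrank_map_add_finrank_ker_inf {V W : Type*} [AddCommGroup V] [Module k V]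
    [AddCommGroup W] [Module k W] [FiniteDimensional k V] (f : V →ₗ[k] W) {U E : Submodule k V}
    (hU : U ≤ E) : finrank k ↥(U.map f) + finrank k ↥(LinearMap.ker f ⊓ E) =
      finrank k ↥(U ⊔ (LinearMap.ker f ⊓ E)) := by
  rw [← finrank_map_add_finrank_inf_ker f (U ⊔ (LinearMap.ker f ⊓ E)), Submodule.map_sup,
    sup_eq_left.2 (show (LinearMap.ker f ⊓ E).map f ≤ U.map f from ?_)]
  · have h : (U ⊔ (LinearMap.ker f ⊓ E)) ⊓ LinearMap.ker f = LinearMap.ker f ⊓ E :=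
      le_antisymm (le_inf inf_le_right (inf_le_left.trans (sup_le hU inf_le_right)))
        (le_inf le_sup_right inf_le_left)
    rw [h]
  · rintro _ ⟨x, hx, rfl⟩
    rw [LinearMap.mem_ker.1 hx.1]
    exact zero_mem _

/-- The arrow map of the extension of `A` by `B` with cocycle `φ`. -/
def twistMap (A B : NilRep n k) (φ : A.M →ₗ[k] B.M) : A.M × B.M →ₗ[k] A.M × B.M :=
  (A.t ∘ₗ LinearMap.fst k A.M B.M).prod
    (φ ∘ₗ LinearMap.fst k A.M B.M + B.t ∘ₗ LinearMap.snd k A.M B.M)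

@[simp]
theorem twistMap_apply (A B : NilRep n k) (φ : A.M →ₗ[k] B.M) (x : A.M × B.M) :
    twistMap A B φ x = (A.t x.1, φ x.1 + B.t x.2) :=
  rfl

theorem twistMap_pow_apply_inr (A B : NilRep n k) (φ : A.M →ₗ[k] B.M) (m : ℕ) (b : B.M) :
    (twistMap A B φ ^ m) (0, b) = (0, (B.t ^ m) b) := by
  induction m with
  | zero => rfl
  | succ m ih => rw [pow_succ', pow_succ', Module.End.mul_apply, ih]; simp

theorem isNilpotent_twistMap (A B : NilRep n k) (φ : A.M →ₗ[k] B.M) :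
    IsNilpotent (twistMap A B φ) := by
  obtain ⟨p, hp⟩ := A.nil
  obtain ⟨q, hq⟩ := B.nil
  have h1 : ∀ m x, ((twistMap A B φ ^ m) x).1 = (A.t ^ m) x.1 := fun m x => by
    induction m with
    | zero => rfl
    | succ m ih => rw [pow_succ', pow_succ', Module.End.mul_apply, twistMap_apply, ih]; rfl
  refine ⟨q + p, LinearMap.ext fun x => ?_⟩
  rw [pow_add, Module.End.mul_apply]
  have h3 : (twistMap A B φ ^ p) x = (0, ((twistMap A B φ ^ p) x).2) :=
    Prod.ext (by rw [h1, hp]; rfl) rfl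
  rw [h3, twistMap_pow_apply_inr, hq]
  rfl

/-- The extension of `A` by `B` with cocycle `φ`. -/
def twist (A B : NilRep n k) (φ : A.M →ₗ[k] B.M) (hφ : ∀ i, φ ∘ₗ A.pr i = B.pr (i + 1) ∘ₗ φ) :
    NilRep n k where
  M := A.M × B.M
  pr i := (A.pr i).prodMap (B.pr i)
  t := twistMap A B φ
  idem i j := by
    ext x <;> simp [NilRep.pr_pr_apply] <;> split_ifs <;> simp
  sum := by
    ext x <;> simp [Prod.fst_sum, Prod.snd_sum, NilRep.sum_pr_apply]
  comm i := by
    have h := LinearMap.congr_fun (hφ i)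
    simp only [LinearMap.comp_apply] at h
    ext x <;> simp [NilRep.t_pr_apply, h]
  nil := isNilpotent_twistMap A B φ

theorem isExtensionOf_twist (A B : NilRep n k) (φ : A.M →ₗ[k] B.M)
    (hφ : ∀ i, φ ∘ₗ A.pr i = B.pr (i + 1) ∘ₗ φ) : IsExtensionOf (twist A B φ hφ) A B := by
  refine ⟨LinearMap.inr k A.M B.M, LinearMap.fst k A.M B.M, ⟨fun i => ?_, ?_⟩, ⟨fun i => ?_, ?_⟩,
    LinearMap.inr_injective, LinearMap.fst_surjective, LinearMap.range_inr k A.M B.M⟩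
  · exact LinearMap.ext fun x => Prod.ext (map_zero (A.pr i)).symm rfl
  · refine LinearMap.ext fun x => Prod.ext (map_zero A.t).symm ?_
    change B.t x = φ 0 + B.t x
    rw [map_zero, zero_add]
  · rfl
  · rfl

theorem level_zero_twist (A B : NilRep n k) (φ : A.M →ₗ[k] B.M)
    (hφ : ∀ i, φ ∘ₗ A.pr i = B.pr (i + 1) ∘ₗ φ) (i : ZMod n) :
    (twist A B φ hφ).level 0 i = (A.level 0 i).prod (B.level 0 i) := by
  rw [NilRep.level_zero, NilRep.level_zero, NilRep.level_zero]
  exact LinearMap.range_prodMap _ _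

theorem twistMap_pow_apply_congr {A B : NilRep n k} {φ φ' : A.M →ₗ[k] B.M} {m : ℕ}
    (h : ∀ j, ∀ x ∈ A.level (m + 1) j, φ' x = φ x) (l : ℕ) (j : ZMod n)
    {x : A.M × B.M} (hx : x.1 ∈ A.level (m + 1) j) :
    (twistMap A B φ' ^ l) x = (twistMap A B φ ^ l) x := by
  induction l generalizing j x with
  | zero => rfl
  | succ l ih =>
    rw [pow_succ, pow_succ, Module.End.mul_apply, Module.End.mul_apply, twistMap_apply,
      twistMap_apply, h j _ hx, ih (j + 1)]
    refine A.level_succ_le _ _ ?_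
    rw [← A.map_t_level]
    exact mem_map_of_mem hx

theorem map_prod_sup {V V' W : Type*} [AddCommGroup V] [AddCommGroup V'] [AddCommGroup W]
    [Module k V] [Module k V'] [Module k W] (f : V × V' →ₗ[k] W) (S : Submodule k V)
    (T : Submodule k V') :
    (S.prod T).map f = S.map (f ∘ₗ LinearMap.inl k V V') ⊔ T.map (f ∘ₗ LinearMap.inr k V V') := by
  rw [Submodule.map_comp, Submodule.map_comp, ← Submodule.map_sup, map_inl, map_inr, prod_sup_prod,
    sup_bot_eq, bot_sup_eq]

theorem sum_comp_pr_apply_of_mem_level {A : NilRep n k} {V : Type*} [AddCommGroup V] [Module k V]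
    (g : ZMod n → A.M →ₗ[k] V) {m : ℕ} {i : ZMod n} {x : A.M} (hx : x ∈ A.level m i) :
    (∑ j, g j ∘ₗ A.pr j) x = g i x := by
  rw [LinearMap.sum_apply, Finset.sum_eq_single i]
  · rw [LinearMap.comp_apply, A.pr_apply_of_mem_level hx, if_pos rfl]
  · intro j _ hj
    rw [LinearMap.comp_apply, A.pr_apply_of_mem_level hx, if_neg hj, map_zero]
  · simp

theorem map_twistMap_prod_level_le {A B : NilRep n k} {φ : A.M →ₗ[k] B.M}
    (hφ : ∀ i, φ ∘ₗ A.pr i = B.pr (i + 1) ∘ₗ φ) (m : ℕ) (i : ZMod n) :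
    ((A.level m i).prod (B.level 0 i)).map (twistMap A B φ) ≤
      (A.level (m + 1) (i + 1)).prod (B.level 0 (i + 1)) := by
  rintro _ ⟨⟨x, y⟩, ⟨hx, hy⟩, rfl⟩
  refine ⟨?_, ?_⟩
  · rw [← A.map_t_level]
    exact mem_map_of_mem hx
  · have h1 : φ x = B.pr (i + 1) (φ x) := by
      have := LinearMap.congr_fun (hφ i) x
      rwa [LinearMap.comp_apply, A.pr_apply_of_mem_level hx, if_pos rfl] at this
    rw [twistMap_apply]
    refine add_mem (h1 ▸ B.pr_mem_level_zero _ _) (B.level_succ_le 0 _ ?_)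
    rw [← B.map_t_level]
    exact mem_map_of_mem hy

theorem finrank_map_eq_of_injective {V W : Type*} [AddCommGroup V] [AddCommGroup W] [Module k V]
    [Module k W] {f : V →ₗ[k] W} (hf : Function.Injective f) (S : Submodule k V) :
    finrank k ↥(S.map f) = finrank k S :=
  (equivMapOfInjective f hf S).finrank_eq.symm

theorem finrank_submodule_prod {V V' : Type*} [AddCommGroup V] [AddCommGroup V'] [Module k V]
    [Module k V'] [FiniteDimensional k V] [FiniteDimensional k V'] (S : Submodule k V)
    (T : Submodule k V') : finrank k ↥(S.prod T) = finrank k S + finrank k T := by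
  have h : S.prod T ⊓ LinearMap.ker (LinearMap.fst k V V') = T.map (LinearMap.inr k V V') := by
    rw [LinearMap.ker_fst, map_inr, LinearMap.range_inr]
    ext ⟨x, y⟩
    simp +contextual [and_comm]
  rw [← finrank_map_add_finrank_inf_ker (LinearMap.fst k V V') (S.prod T), prod_map_fst, h,
    finrank_map_eq_of_injective LinearMap.inr_injective]

theorem exists_twistMap_finrank_level_le (A B : NilRep n k) (m : ℕ) :
    ∃ φ : A.M →ₗ[k] B.M, (∀ i, φ ∘ₗ A.pr i = B.pr (i + 1) ∘ₗ φ) ∧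
      ∀ (i : ZMod n) (l : ℕ), ∃ b c : ℕ, b + c = l ∧
        finrank k (A.level (m + b) (i + b)) + finrank k (B.level c (i + l)) ≤
          finrank k ↥(((A.level m i).prod (B.level 0 i)).map (twistMap A B φ ^ l)) := by
  obtain ⟨p, hp⟩ := A.nil
  obtain ⟨d, hd⟩ : ∃ d, p ≤ m + d := ⟨p, Nat.le_add_left p m⟩
  induction d generalizing m with
  | zero =>
    refine ⟨0, fun i => by simp, fun i l => ⟨0, l, zero_add l, ?_⟩⟩
    rw [Nat.cast_zero, add_zero, A.level_eq_bot (m := m) (pow_eq_zero_of_le hd hp), finrank_bot,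
      zero_add]
    have h := B.map_pow_level 0 l i
    rw [zero_add] at h
    rw [← h, ← finrank_map_eq_of_injective (LinearMap.inr_injective (M := A.M) (R := k))]
    refine finrank_mono ?_
    rintro _ ⟨_, ⟨y, hy, rfl⟩, rfl⟩
    exact ⟨(0, y), ⟨zero_mem _, hy⟩, twistMap_pow_apply_inr A B 0 l y⟩
  | succ d ih =>
    replace ih := ih (m + 1) (by lia)
    obtain ⟨φ, hφ, ih⟩ := ih
    set τ := twistMap A B φ with hτ
    let E : ZMod n → Submodule k (A.M × B.M) := fun i => (A.level (m + 1) i).prod (B.level 0 i)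
    let R : ZMod n → Submodule k (A.M × B.M) := fun i => (E i).map τ
    have hRE : ∀ i, R i ≤ E (i + 1) := fun i =>
      (map_twistMap_prod_level_le hφ (m + 1) i).trans (prod_mono (A.level_succ_le _ _) le_rfl)
    have key : ∀ i, ∃ χ : A.M →ₗ[k] A.M × B.M,
        (∀ x ∈ A.level (m + 1) i, χ x = A.t.prod φ x) ∧ (A.level m i).map χ ≤ E (i + 1) ∧
        (∀ x ∈ A.level m i, LinearMap.fst k A.M B.M (χ x) = A.t x) ∧
        ∀ l, (A.level m i).map χ ⊔ (R i ⊔ (LinearMap.ker (τ ^ l) ⊓ E (i + 1))) = E (i + 1) ∨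
          finrank k ↥((A.level m i).map χ ⊔ (R i ⊔ (LinearMap.ker (τ ^ l) ⊓ E (i + 1)))) +
            finrank k (A.level (m + 1) i) = finrank k (A.level m i) +
              finrank k ↥(R i ⊔ (LinearMap.ker (τ ^ l) ⊓ E (i + 1))) := by
      intro i
      refine exists_generic_extension (A.level_succ_le m i) (hRE i) ?_ (fun _ _ => rfl) ?_ ?_
        (fun _ => le_sup_left) fun l => sup_le (hRE i) inf_le_right
      · rintro _ ⟨x, hx, rfl⟩
        exact ⟨(x, 0), ⟨hx, zero_mem _⟩, by simp [hτ]⟩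
      · have hE : (E (i + 1)).map (LinearMap.fst k A.M B.M) = A.level (m + 1) (i + 1) :=
          prod_map_fst _ _
        rw [A.map_t_level, ← hE]
        exact sup_eq_left.2 (map_mono (hRE i))
      · intro a b hab
        refine sup_le_sup_left (inf_le_inf_right _ fun x hx => ?_) _
        rw [LinearMap.mem_ker] at hx ⊢
        rw [← Nat.sub_add_cancel hab, pow_add, Module.End.mul_apply, hx, map_zero]
    choose χ hχS hχE hχ1 hχF using key
    let φ' : A.M →ₗ[k] B.M := ∑ j, (B.pr (j + 1) ∘ₗ LinearMap.snd k A.M B.M ∘ₗ χ j) ∘ₗ A.pr j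
    have hφ'0 : ∀ i, ∀ x ∈ A.level 0 i, φ' x = B.pr (i + 1) (χ i x).2 := fun i x hx =>
      sum_comp_pr_apply_of_mem_level _ hx
    have hφ'W : ∀ i, ∀ x ∈ A.level m i, φ' x = (χ i x).2 := fun i x hx => by
      have h1 : φ' x = B.pr (i + 1) (χ i x).2 := sum_comp_pr_apply_of_mem_level _ hx
      rw [h1, B.pr_apply_of_mem_level (hχE i (mem_map_of_mem hx)).2, if_pos rfl]
    have hφ'S : ∀ i, ∀ x ∈ A.level (m + 1) i, φ' x = φ x := fun i x hx => by
      rw [hφ'W i x (A.level_succ_le m i hx), hχS i x hx]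
      rfl
    have hφ' : ∀ i, φ' ∘ₗ A.pr i = B.pr (i + 1) ∘ₗ φ' := fun i => by
      ext x
      rw [LinearMap.comp_apply, LinearMap.comp_apply, hφ'0 i _ (A.pr_mem_level_zero i x)]
      conv_rhs => rw [← A.sum_pr_apply x, map_sum, map_sum]
      rw [Finset.sum_eq_single i]
      · rw [hφ'0 i _ (A.pr_mem_level_zero i x), B.pr_pr_apply, if_pos rfl]
      · intro j _ hj
        rw [hφ'0 j _ (A.pr_mem_level_zero j x), B.pr_pr_apply, if_neg]
        exact fun h => hj (add_right_cancel h).symm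
      · simp
    refine ⟨φ', hφ', fun i l => ?_⟩
    obtain _ | l := l
    · refine ⟨0, 0, rfl, ?_⟩
      rw [pow_zero, Module.End.one_eq_id, Submodule.map_id, finrank_submodule_prod,
        Nat.cast_zero, add_zero, add_zero]
    have hU : ((A.level m i).prod (B.level 0 i)).map (twistMap A B φ') =
        (A.level m i).map (χ i) ⊔ R i := by
      have h1 : (A.level m i).map (twistMap A B φ' ∘ₗ LinearMap.inl k A.M B.M) =
          (A.level m i).map (χ i) := by
        refine SetLike.coe_injective ?_
        rw [map_coe, map_coe]
        refine Set.image_congr fun x hx => Prod.ext ?_ ?_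
        · exact (hχ1 i x hx).symm
        · simp [hφ'W i x hx]
      have h2 : twistMap A B φ' ∘ₗ LinearMap.inr k A.M B.M = τ ∘ₗ LinearMap.inr k A.M B.M := by
        ext x <;> simp [hτ]
      have h3 : (A.level (m + 1) i).map (τ ∘ₗ LinearMap.inl k A.M B.M) ≤
          (A.level m i).map (χ i) := by
        rintro _ ⟨x, hx, rfl⟩
        refine ⟨x, A.level_succ_le m i hx, ?_⟩
        rw [hχS i x hx]
        simp [hτ]
      rw [map_prod_sup, h1, h2]
      change _ = _ ⊔ ((A.level (m + 1) i).prod (B.level 0 i)).map τ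
      rw [map_prod_sup, ← sup_assoc, sup_eq_left.2 h3]
    have hUE : (A.level m i).map (χ i) ⊔ R i ≤ E (i + 1) := sup_le (hχE i) (hRE i)
    have hUτ : ((A.level m i).prod (B.level 0 i)).map (twistMap A B φ' ^ (l + 1)) =
        ((A.level m i).map (χ i) ⊔ R i).map (τ ^ l) := by
      rw [pow_succ, Module.End.mul_eq_comp, Submodule.map_comp, hU]
      refine SetLike.coe_injective ?_
      rw [map_coe, map_coe]
      exact Set.image_congr fun x hx => twistMap_pow_apply_congr hφ'S l (i + 1) (hUE hx).1
    have hRτ : (R i).map (τ ^ l) = (E i).map (τ ^ (l + 1)) := by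
      rw [pow_succ, Module.End.mul_eq_comp, Submodule.map_comp]
    rw [hUτ]
    have e1 := finrank_map_add_finrank_ker_inf (τ ^ l) hUE
    have e2 := finrank_map_add_finrank_ker_inf (τ ^ l) (hRE i)
    have e3 := finrank_map_add_finrank_ker_inf (τ ^ l) (le_refl (E (i + 1)))
    rw [sup_assoc] at e1
    rw [sup_eq_left.2 inf_le_right] at e3
    rcases hχF i l with hF | hF
    · obtain ⟨b, c, hbc, hle⟩ := ih (i + 1) l
      refine ⟨b + 1, c, by lia, ?_⟩
      rw [hF] at e1
      have h1 : m + (b + 1) = m + 1 + b := by ring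
      have h2 : i + ((b + 1 : ℕ) : ZMod n) = i + 1 + b := by push_cast; ring
      have h3 : i + ((l + 1 : ℕ) : ZMod n) = i + 1 + l := by push_cast; ring
      rw [h1, h2, h3]
      change _ ≤ finrank k ↥((E (i + 1)).map (τ ^ l)) at hle
      lia
    · obtain ⟨b, c, hbc, hle⟩ := ih i (l + 1)
      refine ⟨b, c, hbc, ?_⟩
      rw [hRτ] at e2
      have h1 := finrank_map_add_finrank_inf_ker (A.t ^ b) (A.level m i)
      have h2 := finrank_map_add_finrank_inf_ker (A.t ^ b) (A.level (m + 1) i)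
      have h3 : finrank k ↥(A.level (m + 1) i ⊓ LinearMap.ker (A.t ^ b)) ≤
        finrank k ↥(A.level m i ⊓ LinearMap.ker (A.t ^ b)) :=
          finrank_mono (inf_le_inf_right _ (A.level_succ_le m i))
      rw [A.map_pow_level] at h1 h2
      change _ ≤ finrank k ↥((E i).map (τ ^ (l + 1))) at hle
      lia

/-- Some extension of `A` by `B` attains the largest ranks allowed by subadditivity. -/
theorem exists_isExtensionOf_le_finrank_level (A B : NilRep n k) :
    ∃ C : NilRep n k, IsExtensionOf C A B ∧ ∀ (i : ZMod n) (l : ℕ), ∃ b c : ℕ, b + c = l ∧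
      finrank k (A.level b (i + b)) + finrank k (B.level c (i + l)) ≤
        finrank k (C.level l (i + l)) := by
  obtain ⟨φ, hφ, h⟩ := exists_twistMap_finrank_level_le A B 0
  refine ⟨twist A B φ hφ, isExtensionOf_twist A B φ hφ, fun i l => ?_⟩
  obtain ⟨b, c, hbc, hle⟩ := h i l
  refine ⟨b, c, hbc, ?_⟩
  have h1 := (twist A B φ hφ).map_pow_level 0 l i
  rw [zero_add, level_zero_twist] at h1
  rw [zero_add] at hle
  rw [← h1]
  exact hle

theorem exists_map_level_eq {A A' : NilRep n k}
    (h : ∀ m i, finrank k (A.level m i) = finrank k (A'.level m i)) (m : ℕ) :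
    ∃ f : A.M →ₗ[k] A'.M, (∀ i, (A.level m i).map f = A'.level m i) ∧
      ∀ i, ∀ x ∈ A.level m i, A'.t (f x) = f (A.t x) := by
  obtain ⟨p, hp⟩ := A.nil
  obtain ⟨q, hq⟩ := A'.nil
  obtain ⟨d, hd⟩ : ∃ d, p + q ≤ m + d := ⟨p + q, Nat.le_add_left _ m⟩
  induction d generalizing m with
  | zero =>
    have h1 := A.level_eq_bot (m := m) (pow_eq_zero_of_le (by lia) hp)
    have h2 := A'.level_eq_bot (m := m) (pow_eq_zero_of_le (by lia) hq)
    exact ⟨0, fun i => by rw [h1, h2, Submodule.map_bot], fun i x _ => by simp⟩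
  | succ d ih =>
    obtain ⟨f, hf, hft⟩ := ih (m + 1) (by lia)
    have key : ∀ i, ∃ χ : A.M →ₗ[k] A'.M, (∀ x ∈ A.level (m + 1) i, χ x = f x) ∧
        (A.level m i).map χ = A'.level m i ∧
        ∀ x ∈ A.level m i, A'.t (χ x) = f (A.t x) := by
      intro i
      obtain ⟨χ, h1, h2, h3, h4⟩ := exists_generic_extension (k := k) (S := A.level (m + 1) i)
        (W := A.level m i) (E := A'.level m i) (R := A'.level (m + 1) i) (ψ := f) (α := f ∘ₗ A.t)
        (π := A'.t) (F := fun _ => A'.level (m + 1) i) (A.level_succ_le m i)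
        (A'.level_succ_le m i) (hf i).le (hft i) (by
          rw [Submodule.map_comp, A.map_t_level, hf, A'.map_t_level, A'.map_t_level,
            sup_eq_left]
          exact A'.level_succ_le _ _)
        monotone_const (fun _ => le_rfl) fun _ => A'.level_succ_le m i
      have h5 : A'.level (m + 1) i ≤ (A.level m i).map χ := by
        rw [← hf]
        rintro _ ⟨x, hx, rfl⟩
        exact ⟨x, A.level_succ_le m i hx, h1 x hx⟩
      refine ⟨χ, h1, ?_, h3⟩
      have h4 := h4 0
      rw [sup_eq_left.2 h5] at h4
      rcases h4 with h4 | h4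
      · exact h4
      · refine eq_of_le_of_finrank_eq h2 ?_
        rw [h, ← h] at h4
        have := h m i
        lia
    choose χ hχS hχ hχt using key
    have hsum : ∀ i, ∀ x ∈ A.level m i, (∑ j, χ j ∘ₗ A.pr j) x = χ i x := fun i x hx =>
      sum_comp_pr_apply_of_mem_level χ hx
    refine ⟨∑ j, χ j ∘ₗ A.pr j, fun i => ?_, fun i x hx => ?_⟩
    · rw [← hχ]
      refine SetLike.coe_injective ?_
      rw [map_coe, map_coe]
      exact Set.image_congr (hsum i)
    · have htx : A.t x ∈ A.level (m + 1) (i + 1) := by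
        rw [← A.map_t_level]
        exact mem_map_of_mem hx
      rw [hsum i x hx, hχt i x hx, hsum (i + 1) _ (A.level_succ_le _ _ htx), hχS _ _ htx]

theorem exists_isRepHom_surjective {A A' : NilRep n k}
    (h : ∀ m i, finrank k (A.level m i) = finrank k (A'.level m i)) :
    ∃ f : A.M →ₗ[k] A'.M, IsRepHom A A' f ∧ Function.Surjective f := by
  obtain ⟨f, hf, hft⟩ := exists_map_level_eq h 0
  refine ⟨f, ⟨fun i => LinearMap.ext fun x => ?_, LinearMap.ext fun x => ?_⟩, fun y => ?_⟩
  · have hmem : ∀ j, f (A.pr j x) ∈ A'.level 0 j := fun j => by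
      rw [← hf]
      exact mem_map_of_mem (A.pr_mem_level_zero j x)
    rw [LinearMap.comp_apply, LinearMap.comp_apply]
    conv_rhs => rw [← A.sum_pr_apply x, map_sum, map_sum]
    simp_rw [A'.pr_apply_of_mem_level (hmem _)]
    simp
  · rw [LinearMap.comp_apply, LinearMap.comp_apply, ← A.sum_pr_apply x]
    simp only [map_sum]
    exact Finset.sum_congr rfl fun i _ => (hft i _ (A.pr_mem_level_zero i x)).symm
  · rw [← A'.sum_pr_apply y, ← LinearMap.mem_range]
    refine sum_mem fun i _ => LinearMap.map_le_range (p := A.level 0 i) ?_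
    rw [hf]
    exact A'.pr_mem_level_zero i y

/-- A representation is determined up to isomorphism by the dimensions of its levels. -/
theorem isoRep_of_finrank_level_eq {A A' : NilRep n k}
    (h : ∀ m i, finrank k (A.level m i) = finrank k (A'.level m i)) : IsoRep A A' := by
  obtain ⟨f, hf, hfs⟩ := exists_isRepHom_surjective h
  obtain ⟨g, -, hgs⟩ := exists_isRepHom_surjective fun m i => (h m i).symm
  have hdim : finrank k A.M = finrank k A'.M :=
    le_antisymm (LinearMap.finrank_le_finrank_of_surjective hgs)
      (LinearMap.finrank_le_finrank_of_surjective hfs)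
  exact ⟨LinearEquiv.ofBijective f
    ⟨(LinearMap.injective_iff_surjective_of_finrank_eq_finrank hdim).2 hfs, hfs⟩, hf⟩

/-- The arrow map of the uniserial representation of length `l + 1`. -/
def uniserialMap (k : Type) [Field k] (l : ℕ) : (Fin (l + 1) → k) →ₗ[k] (Fin (l + 1) → k) where
  toFun x a := if h : (a : ℕ) + 1 < l + 1 then x ⟨a + 1, h⟩ else 0
  map_add' x y := by
    ext a
    by_cases h : (a : ℕ) < l <;> simp [h]
  map_smul' c x := by
    ext a
    by_cases h : (a : ℕ) < l <;> simp [h]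

theorem uniserialMap_apply (l : ℕ) (x : Fin (l + 1) → k) (a : Fin (l + 1)) :
    uniserialMap k l x a = if h : (a : ℕ) + 1 < l + 1 then x ⟨a + 1, h⟩ else 0 :=
  rfl

theorem uniserialMap_pow_apply (l m : ℕ) (x : Fin (l + 1) → k) (a : Fin (l + 1)) :
    (uniserialMap k l ^ m) x a = if h : (a : ℕ) + m < l + 1 then x ⟨a + m, h⟩ else 0 := by
  induction m generalizing a with
  | zero =>
    rw [dif_pos (show (a : ℕ) + 0 < l + 1 from a.isLt)]
    rfl
  | succ m ih =>
    rw [pow_succ', Module.End.mul_apply, uniserialMap_apply]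
    split_ifs with h1 h2 h2
    · rw [ih, dif_pos (by simp only; lia)]
      congr 2
      simp only
      lia
    · rw [ih, dif_neg (by simp only; lia)]
    · lia
    · rfl

/-- The uniserial representation of length `l + 1` with top coordinate in degree `j`. -/
def uniserial (k : Type) [Field k] (l : ℕ) (j : ZMod n) : NilRep n k where
  M := Fin (l + 1) → k
  pr i := LinearMap.pi fun a => if j - (a : ℕ) = i then LinearMap.proj a else 0
  t := uniserialMap k l
  idem i i' := by
    refine LinearMap.ext fun x => funext fun a => ?_
    by_cases h1 : j - (a : ℕ) = i <;> by_cases h2 : i = i' <;> simp_all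
  sum := by
    refine LinearMap.ext fun x => funext fun a => ?_
    rw [LinearMap.sum_apply, Finset.sum_apply, Finset.sum_eq_single (j - (a : ℕ))]
    · simp
    · intro i _ hi
      simp [hi.symm]
    · simp
  comm i := by
    refine LinearMap.ext fun x => funext fun a => ?_
    have h : j - ((a : ℕ) + 1) = i ↔ j - (a : ℕ) = i + 1 := by
      rw [← sub_sub, sub_eq_iff_eq_add]
    by_cases h1 : j - (a : ℕ) = i + 1 <;> by_cases h2 : (a : ℕ) < l <;>
      simp [uniserialMap_apply, h, h1, h2]
  nil := ⟨l + 1, LinearMap.ext fun x => funext fun a => by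
    rw [uniserialMap_pow_apply, dif_neg (by lia)]
    rfl⟩

theorem uniserial_pr_apply (l : ℕ) (j i : ZMod n) (x : Fin (l + 1) → k) (a : Fin (l + 1)) :
    (uniserial k l j).pr i x a = if j - (a : ℕ) = i then x a else 0 := by
  change (if j - (a : ℕ) = i then LinearMap.proj a else 0 : (Fin (l + 1) → k) →ₗ[k] k) x = _
  split_ifs <;> rfl

/-- Evaluating a morphism to a uniserial representation at its top coordinate. -/
def homUniserialToDual (C : NilRep n k) (l : ℕ) (j : ZMod n) :
    HomSub C (uniserial k l j) →ₗ[k] Dual k C.M where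
  toFun f := (LinearMap.proj 0 : (Fin (l + 1) → k) →ₗ[k] k) ∘ₗ f.1
  map_add' _ _ := rfl
  map_smul' _ _ := rfl

theorem apply_eq_of_isRepHom_uniserial {C : NilRep n k} {l : ℕ} {j : ZMod n}
    {f : C.M →ₗ[k] (Fin (l + 1) → k)} (hf : IsRepHom C (uniserial k l j) f) (x : C.M)
    (a : Fin (l + 1)) : f x a = f ((C.t ^ (a : ℕ)) x) 0 := by
  have h := congrFun (hf.apply_pow_t a x) 0
  refine Eq.trans ?_ h.symm
  refine Eq.trans ?_ (uniserialMap_pow_apply l a (f x) 0).symm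
  rw [dif_pos (by rw [Fin.val_zero, zero_add]; exact a.isLt)]
  exact congrArg (f x) (Fin.ext (by simp))

theorem homUniserialToDual_injective (C : NilRep n k) (l : ℕ) (j : ZMod n) :
    Function.Injective (homUniserialToDual C l j) := by
  intro f g h
  refine Subtype.ext (LinearMap.ext fun x => funext fun a => ?_)
  refine (apply_eq_of_isRepHom_uniserial f.2 x a).trans ?_
  refine Eq.trans ?_ (apply_eq_of_isRepHom_uniserial g.2 x a).symm
  exact LinearMap.congr_fun h _

theorem range_homUniserialToDual (C : NilRep n k) (l : ℕ) (j : ZMod n) :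
    LinearMap.range (homUniserialToDual C l j) =
      (LinearMap.ker (C.pr j) ⊔ C.level (l + 1) j).dualAnnihilator := by
  rw [dualAnnihilator_sup_eq]
  refine le_antisymm ?_ ?_
  · rintro _ ⟨⟨f, hf⟩, rfl⟩
    have h1 : ∀ x, f (C.pr j x) 0 = f x 0 := fun x => by
      refine (congrFun (LinearMap.congr_fun (hf.1 j) x) 0).trans ?_
      refine (uniserial_pr_apply l j j (f x) 0).trans ?_
      simp
    refine ⟨(mem_dualAnnihilator _).2 fun x hx => ?_, (mem_dualAnnihilator _).2 ?_⟩
    · refine (h1 x).symm.trans ?_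
      rw [LinearMap.mem_ker.1 hx, map_zero]
      rfl
    · rintro _ ⟨x, rfl⟩
      refine (h1 _).trans ?_
      refine (congrFun (hf.apply_pow_t (l + 1) x) 0).trans ?_
      refine (uniserialMap_pow_apply l (l + 1) (f x) 0).trans ?_
      rw [dif_neg (by lia)]
  · rintro ξ ⟨h1, h2⟩
    replace h1 := (mem_dualAnnihilator _).1 h1
    replace h2 := (mem_dualAnnihilator _).1 h2
    have h3 : ∀ i x, ξ (C.pr i x) = if i = j then ξ x else 0 := fun i x => by
      split_ifs with hi
      · have := h1 (x - C.pr j x) (by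
          rw [LinearMap.mem_ker, map_sub, C.pr_pr_apply, if_pos rfl, sub_self])
        rw [map_sub, sub_eq_zero] at this
        rw [hi, this]
      · refine h1 _ ?_
        rw [LinearMap.mem_ker, C.pr_pr_apply, if_neg (Ne.symm hi)]
    have h4 : ∀ x, ξ ((C.t ^ (l + 1)) x) = 0 := fun x => by
      rw [← h2 _ ⟨x, rfl⟩, LinearMap.comp_apply, h3, if_pos rfl]
    let f : C.M →ₗ[k] (Fin (l + 1) → k) := LinearMap.pi fun a => ξ ∘ₗ C.t ^ (a : ℕ)
    refine ⟨⟨f, fun i => LinearMap.ext fun x => funext fun a => ?_,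
      LinearMap.ext fun x => funext fun a => ?_⟩, ?_⟩
    · refine Eq.trans ?_ (uniserial_pr_apply l j i (f x) a).symm
      change ξ (((C.t ^ (a : ℕ)) ∘ₗ C.pr i) x) = if _ then ξ ((C.t ^ (a : ℕ)) x) else 0
      rw [C.pow_t_comp_pr, LinearMap.comp_apply, h3]
      refine if_congr ?_ rfl rfl
      rw [sub_eq_iff_eq_add, eq_comm]
    · change ξ ((C.t ^ (a : ℕ)) (C.t x)) = if h : (a : ℕ) + 1 < l + 1 then
        ξ ((C.t ^ ((a : ℕ) + 1)) x) else 0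
      rw [← Module.End.mul_apply, ← pow_succ]
      split_ifs with h
      · rfl
      · rw [show (a : ℕ) = l by lia]
        exact h4 x
    · rfl

/-- The dimensions of the levels of `C` are determined by morphisms to uniserial representations. -/
theorem homDim_uniserial_add (C : NilRep n k) (l : ℕ) (j : ZMod n) :
    homDim C (uniserial k l j) + finrank k (C.level (l + 1) j) = dimAt C j := by
  have h1 : homDim C (uniserial k l j) =
      finrank k ↥(LinearMap.ker (C.pr j) ⊔ C.level (l + 1) j).dualAnnihilator := by
    rw [← range_homUniserialToDual]
    exact (LinearMap.finrank_range_of_inj (homUniserialToDual_injective C l j)).symm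
  have h2 := Subspace.finrank_add_finrank_dualAnnihilator_eq
    (LinearMap.ker (C.pr j) ⊔ C.level (l + 1) j)
  have hd : Disjoint (LinearMap.ker (C.pr j)) (C.level (l + 1) j) := by
    rw [disjoint_def]
    intro x hx hx'
    rw [← LinearMap.mem_ker.1 hx, C.pr_apply_of_mem_level hx', if_pos rfl]
  rw [finrank_sup_of_disjoint hd] at h2
  have h3 := LinearMap.finrank_range_add_finrank_ker (C.pr j)
  rw [dimAt]
  lia

theorem DegLe.finrank_level_le {C G : NilRep n k} (h : DegLe C G) (m : ℕ) (i : ZMod n) :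
    finrank k (C.level m i) ≤ finrank k (G.level m i) := by
  obtain _ | m := m
  · rw [NilRep.level_zero, NilRep.level_zero]
    exact (h.1 i).le
  · have h1 := homDim_uniserial_add C m i
    have h2 := homDim_uniserial_add G m i
    have h3 := h.1 i
    have h4 := h.2 (uniserial k m i)
    lia

theorem IsGenericExt.le_finrank_level {A B G : NilRep n k} (h : IsGenericExt A B G) (i : ZMod n)
    (l : ℕ) : ∃ b c : ℕ, b + c = l ∧ finrank k (A.level b (i + b)) +
      finrank k (B.level c (i + b + c)) ≤ finrank k (G.level l (i + l)) := by
  obtain ⟨C, hC, hle⟩ := exists_isExtensionOf_le_finrank_level A B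
  obtain ⟨b, c, hbc, hle⟩ := hle i l
  refine ⟨b, c, hbc, ?_⟩
  rw [add_assoc i, ← Nat.cast_add, hbc]
  exact hle.trans ((h.2 C hC).finrank_level_le l _)

theorem IsGenericExt.isoRep {A B G G' : NilRep n k} (h : IsGenericExt A B G)
    (h' : IsGenericExt A B G') : IsoRep G G' :=
  isoRep_of_finrank_level_eq fun m i =>
    le_antisymm ((h'.2 G h.1).finrank_level_le m i) ((h.2 G' h'.1).finrank_level_le m i)

theorem IsGenericExt.isoRep_assoc {L M N G₁ G₂ H₁ H₂ : NilRep n k} (hG₁ : IsGenericExt M N G₁)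
    (hG₂ : IsGenericExt L G₁ G₂) (hH₁ : IsGenericExt L M H₁) (hH₂ : IsGenericExt H₁ N H₂) :
    IsoRep G₂ H₂ := by
  refine isoRep_of_finrank_level_eq fun m i => ?_
  obtain ⟨i, rfl⟩ : ∃ i', i = i' + m := ⟨i - m, by ring⟩
  refine le_antisymm ?_ ?_
  · obtain ⟨d, c, hdc, h1⟩ := hH₂.le_finrank_level i m
    obtain ⟨a, b, hab, h2⟩ := hH₁.le_finrank_level i d
    have h3 := hG₂.1.finrank_level_le a (b + c) (i + a)
    have h4 := hG₁.1.finrank_level_le b c (i + a + b)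
    have e1 : a + (b + c) = m := by lia
    have e2 : i + a + ((b + c : ℕ) : ZMod n) = i + m := by rw [← e1]; push_cast; ring
    have e3 : i + a + b + c = i + m := by rw [← e1]; push_cast; ring
    have e4 : i + d + c = i + m := by rw [← hdc]; push_cast; ring
    rw [e1, e2] at h3
    rw [e3] at h4
    rw [e4] at h1
    lia
  · obtain ⟨a, e, hae, h1⟩ := hG₂.le_finrank_level i m
    obtain ⟨b, c, hbc, h2⟩ := hG₁.le_finrank_level (i + a) e
    have h3 := hH₂.1.finrank_level_le (a + b) c (i + a + b)
    have h4 := hH₁.1.finrank_level_le a b (i + a)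
    have e1 : a + b + c = m := by lia
    have e2 : i + a + b + c = i + m := by rw [← e1]; push_cast; ring
    have e3 : i + a + e = i + m := by rw [← hae]; push_cast; ring
    rw [e1, e2] at h3
    rw [e2, e3] at h2
    rw [e3] at h1
    lia

/-- The generic extension operation on (isomorphism classes of) nilpotent representations of
the cyclic quiver is associative, `L * (M * N) ≅ (L * M) * N`, and well defined up to
isomorphism; consequently the isomorphism classes form a monoid under `[M]*[N] = [M*N]`
with identity the zero representation. -/
theorem stmt5 (n : ℕ) [NeZero n] (k : Type) [Field k] :
    (∀ G G' A B : NilRep n k, IsGenericExt A B G → IsGenericExt A B G' → IsoRep G G') ∧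
    (∀ L M N G₁ G₂ H₁ H₂ : NilRep n k,
      IsGenericExt M N G₁ → IsGenericExt L G₁ G₂ →
      IsGenericExt L M H₁ → IsGenericExt H₁ N H₂ → IsoRep G₂ H₂) := by
  exact ⟨fun _ _ _ _ h h' => h.isoRep h', fun _ _ _ _ _ _ _ h1 h2 h3 h4 =>
    h1.isoRep_assoc h2 h3 h4⟩
end
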